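/- Let (ñ₁, J̃₁, Ẽ₁, Ṽ₁) and (ñ₂, J̃₂, Ẽ₂, Ṽ₂) be two solutions of the perturbation initial-boundary value problem on [0, t*] with the same initial data and the same boundary data, each having the regularity ñ_i ∈ H¹(0,t*;H²) ∩ L²(0,t*;H⁴), J̃_i ∈ H¹(0,t*;H¹) ∩ L²(0,t*;H³), Ẽ_i ∈ H¹(0,t*;H¹) ∩ L²(0,t*;H³), Ṽ_i ∈ H¹(0,t*;H⁴) ∩ L²(0,t*;H⁶). Then ñ₁ = ñ₂, J̃₁ = J̃₂, Ẽ₁ = Ẽ₂ and Ṽ₁ = Ṽ₂ on [0,1] × [0, t*]. -/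

import Mathlib

open MeasureTheory Set

noncomputable section

/-- The squared `L²(0,1)` norm of a function. -/
def L2sq (f : ℝ → ℝ) : ℝ := ∫ x in (0:ℝ)..1, (f x) ^ 2

/-- The squared Sobolev `H^k(0,1)` norm of a function (classical derivatives). -/
def sobSq (k : ℕ) (f : ℝ → ℝ) : ℝ :=
  ∑ i ∈ Finset.range (k + 1), L2sq (iteratedDeriv i f)

/-- `δ₀ = ‖ρ_x‖_{H³(0,1)}`. -/
def delta0 (ρ : ℝ → ℝ) : ℝ := Real.sqrt (sobSq 3 (deriv ρ))

/-- Assumption (A1): `ρ(0) = ρ(1)`, `ρ ∈ C⁴` and `ρ > 0` on `[0,1]`. -/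
def AssumpA1 (ρ : ℝ → ℝ) : Prop :=
  ρ 0 = ρ 1 ∧ ContDiff ℝ 4 ρ ∧ ∀ x ∈ Icc (0:ℝ) 1, 0 < ρ x

/-- Assumption (A2). -/
def AssumpA2 (ν τ lam μ : ℝ) (ρ : ℝ → ℝ) : Prop :=
  ∃ α₀ ∈ Ioo (0:ℝ) 1, ∀ x ∈ Icc (0:ℝ) 1,
    1 / α₀ < Real.sqrt 2 * τ * ν * (2 * μ + 5) * ρ x / (3 * lam ^ 2)

/-- The additional condition (1.6)/(newcond1) of the stability theorem. -/
def NewCond (ν τ lam μ : ℝ) (ρ : ℝ → ℝ) : Prop :=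
  ∀ x ∈ Icc (0:ℝ) 1,
    1 < τ * (2 + τ * ν) * (2 * μ + 5) * (μ * ν * lam ^ 2 + ν * ρ x) / (3 * lam ^ 2)

/-- Membership in `H^k(0,1)` (square-integrability of the classical derivatives). -/
def MemH (k : ℕ) (f : ℝ → ℝ) : Prop :=
  ∀ i ≤ k, IntervalIntegrable (fun x => (iteratedDeriv i f x) ^ 2) volume 0 1

/-- Time derivative of a function of time and space. -/
def tderiv (f : ℝ → ℝ → ℝ) (t x : ℝ) : ℝ := deriv (fun s => f s x) t

/-- Membership in `L²(0,T;H^k(0,1))`. -/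
def MemL2H (k : ℕ) (T : ℝ) (f : ℝ → ℝ → ℝ) : Prop :=
  IntervalIntegrable (fun t => sobSq k (f t)) volume 0 T

/-- Membership in `H¹(0,T;H^k(0,1))`. -/
def MemH1H (k : ℕ) (T : ℝ) (f : ℝ → ℝ → ℝ) : Prop :=
  MemL2H k T f ∧ IntervalIntegrable (fun t => sobSq k (fun x => tderiv f t x)) volume 0 T

/-- A (classical) steady-state solution of the full viscous quantum hydrodynamic
boundary value problem (1.2)--(1.4) on `[0,1]`. -/
structure IsSteadySol (ν ε τ lam μ Jb Vb : ℝ) (ρ n J E V : ℝ → ℝ) : Prop where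
  smooth_n : ContDiff ℝ 4 n
  smooth_J : ContDiff ℝ 3 J
  smooth_E : ContDiff ℝ 3 E
  smooth_V : ContDiff ℝ 6 V
  npos : ∀ x ∈ Icc (0:ℝ) 1, 0 < n x
  eq_mass : ∀ x ∈ Icc (0:ℝ) 1, -ν * iteratedDeriv 2 n x + deriv J x = 0
  eq_mom : ∀ x ∈ Icc (0:ℝ) 1,
    -ν * iteratedDeriv 2 J x + J x / τ
      + (2/3) * deriv (fun y => (J y) ^ 2 / n y) x
      + (2/3) * deriv E x
      - (ε ^ 2 / 9) * n x *
          deriv (fun y => iteratedDeriv 2 (fun z => Real.sqrt (n z)) y / Real.sqrt (n y)) x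
      - n x * deriv V x + μ * deriv n x = 0
  eq_energy : ∀ x ∈ Icc (0:ℝ) 1,
    -ν * iteratedDeriv 2 E x + (2/τ) * E x - (3/τ) * n x + μ * deriv J x
      + (5/3) * deriv (fun y => J y / n y * E y) x
      - (1/3) * deriv (fun y => (J y) ^ 3 / (n y) ^ 2) x
      - (ε ^ 2 / 18) * deriv (fun y =>
          J y * iteratedDeriv 2 n y / n y - J y * (deriv n y) ^ 2 / (n y) ^ 2) x
      - J x * deriv V x = 0
  eq_poisson : ∀ x ∈ Icc (0:ℝ) 1, lam ^ 2 * iteratedDeriv 2 V x = n x - ρ x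
  bc_n : ∀ k : ℕ, k ≤ 3 →
      iteratedDeriv k n 0 = iteratedDeriv k ρ 0 ∧
      iteratedDeriv k n 1 = iteratedDeriv k ρ 1 ∧
      iteratedDeriv k ρ 0 = iteratedDeriv k ρ 1
  bc_J : J 0 = Jb ∧ J 1 = Jb
  bc_E : E 0 = (3/2) * ρ 0 ∧ E 1 = (3/2) * ρ 0
  bc_V : V 0 = 0 ∧ V 1 = Vb ∧ deriv V 0 = 0 ∧ deriv V 1 = 0

/-- The explicit quadratic remainder `g₁` of the perturbation system (3.2). -/
def g1fun (ε : ℝ) (nstar Jstar Vstar : ℝ → ℝ) (tn tJ tV : ℝ → ℝ) : ℝ → ℝ := fun x =>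
  -(ε ^ 2 / 18) *
      (2 * deriv (fun y => nstar y + tn y) x * iteratedDeriv 2 (fun y => nstar y + tn y) x
          / (nstar x + tn x)
        - 2 * deriv nstar x * iteratedDeriv 2 nstar x / nstar x
        - (deriv (fun y => nstar y + tn y) x) ^ 3 / (nstar x + tn x)
        + (deriv nstar x) ^ 3 / nstar x)
    - (2/3) * deriv (fun y =>
        (Jstar y + tJ y) ^ 2 / (nstar y + tn y) - (Jstar y) ^ 2 / nstar y) x
    + deriv Vstar x * tn x + tn x * deriv tV x

/-- The explicit quadratic remainder `g₂` of the perturbation system (3.2). -/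
def g2fun (ε : ℝ) (nstar Jstar Estar Vstar : ℝ → ℝ) (tn tJ tE tV : ℝ → ℝ) : ℝ → ℝ := fun x =>
  -(5/3) * deriv (fun y =>
      (Jstar y + tJ y) / (nstar y + tn y) * (Estar y + tE y)
        - Jstar y / nstar y * Estar y - (3/2) * tJ y) x
    + (1/3) * deriv (fun y =>
        (Jstar y + tJ y) ^ 3 / (nstar y + tn y) ^ 2 - (Jstar y) ^ 3 / (nstar y) ^ 2) x
    + deriv Vstar x * tJ x + tJ x * deriv tV x + Jstar x * deriv tV x
    + (ε ^ 2 / 18) * deriv (fun y =>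
        (Jstar y + tJ y) * iteratedDeriv 2 (fun z => nstar z + tn z) y / (nstar y + tn y)
          - Jstar y * iteratedDeriv 2 nstar y / nstar y
          - (Jstar y + tJ y) * (deriv (fun z => nstar z + tn z) y) ^ 2 / (nstar y + tn y) ^ 2
          + Jstar y * (deriv nstar y) ^ 2 / (nstar y) ^ 2) x

/-- A (classical) solution of the perturbation initial-boundary value problem
(3.2)--(3.3) around the steady state, on `[0,1] × [0,T]`. -/
structure IsPerturbSol (ν ε τ lam μ T : ℝ) (nstar Jstar Estar Vstar : ℝ → ℝ)
    (tn tJ tE tV : ℝ → ℝ → ℝ) : Prop where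
  reg_n : ∀ t ∈ Icc (0:ℝ) T, ContDiff ℝ 4 (tn t)
  reg_J : ∀ t ∈ Icc (0:ℝ) T, ContDiff ℝ 3 (tJ t)
  reg_E : ∀ t ∈ Icc (0:ℝ) T, ContDiff ℝ 3 (tE t)
  reg_V : ∀ t ∈ Icc (0:ℝ) T, ContDiff ℝ 6 (tV t)
  reg_t : ∀ t ∈ Icc (0:ℝ) T, ∀ x ∈ Icc (0:ℝ) 1,
      DifferentiableAt ℝ (fun s => tn s x) t ∧ DifferentiableAt ℝ (fun s => tJ s x) t ∧
      DifferentiableAt ℝ (fun s => tE s x) t ∧ DifferentiableAt ℝ (fun s => tV s x) t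
  npos : ∀ t ∈ Icc (0:ℝ) T, ∀ x ∈ Icc (0:ℝ) 1, 0 < nstar x + tn t x
  eq1 : ∀ t ∈ Icc (0:ℝ) T, ∀ x ∈ Icc (0:ℝ) 1,
    tderiv tn t x - ν * iteratedDeriv 2 (tn t) x + deriv (tJ t) x = 0
  eq2 : ∀ t ∈ Icc (0:ℝ) T, ∀ x ∈ Icc (0:ℝ) 1,
    tderiv tJ t x - ν * iteratedDeriv 2 (tJ t) x + tJ t x / τ
      - (ε ^ 2 / 18) * iteratedDeriv 3 (tn t) x + (2/3) * deriv (tE t) x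
      - nstar x * deriv (tV t) x + μ * deriv (tn t) x
      = g1fun ε nstar Jstar Vstar (tn t) (tJ t) (tV t) x
  eq3 : ∀ t ∈ Icc (0:ℝ) T, ∀ x ∈ Icc (0:ℝ) 1,
    tderiv tE t x - ν * iteratedDeriv 2 (tE t) x + (2/τ) * tE t x - (3/τ) * tn t x
      + (μ + 5/2) * deriv (tJ t) x
      = g2fun ε nstar Jstar Estar Vstar (tn t) (tJ t) (tE t) (tV t) x
  eq4 : ∀ t ∈ Icc (0:ℝ) T, ∀ x ∈ Icc (0:ℝ) 1,
    -(lam ^ 2) * iteratedDeriv 2 (tV t) x = -(tn t x)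
  bc_n : ∀ t ∈ Icc (0:ℝ) T, ∀ k : ℕ, k ≤ 3 →
      iteratedDeriv k (tn t) 0 = 0 ∧ iteratedDeriv k (tn t) 1 = 0
  bc_JE : ∀ t ∈ Icc (0:ℝ) T, ∀ l : ℕ, l ≤ 2 →
      iteratedDeriv l (tJ t) 0 = 0 ∧ iteratedDeriv l (tJ t) 1 = 0 ∧
      iteratedDeriv l (tE t) 0 = 0 ∧ iteratedDeriv l (tE t) 1 = 0
  bc_V : ∀ t ∈ Icc (0:ℝ) T,
      tV t 0 = 0 ∧ tV t 1 = 0 ∧ deriv (tV t) 0 = 0 ∧ deriv (tV t) 1 = 0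

section

open Filter Topology

theorem abs_intervalIntegral_le_of_mem_unit {φ : ℝ → ℝ} (hφ : ContinuousOn φ (Icc (0:ℝ) 1))
    {x y : ℝ} (hx : x ∈ Icc (0:ℝ) 1) (hy : y ∈ Icc (0:ℝ) 1) :
    |∫ z in y..x, φ z| ≤ ∫ z in (0:ℝ)..1, |φ z| := by
  have h1 : |∫ z in y..x, φ z| ≤ ∫ z in Set.uIoc y x, |φ z| := by
    simpa [Real.norm_eq_abs] using
      intervalIntegral.norm_integral_le_integral_norm_uIoc (f := φ) (a := y) (b := x) (μ := volume)
  refine h1.trans ?_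
  rw [intervalIntegral.integral_of_le zero_le_one]
  refine setIntegral_mono_set ?_ (ae_of_all _ fun z => abs_nonneg _) ?_
  · exact (hφ.abs.integrableOn_Icc).mono_set Ioc_subset_Icc_self
  · refine LE.le.eventuallyLE ?_
    intro z hz
    rw [Set.mem_uIoc] at hz
    rcases hz with ⟨h, h'⟩ | ⟨h, h'⟩
    · exact ⟨hy.1.trans_lt h, h'.trans hx.2⟩
    · exact ⟨hx.1.trans_lt h, h'.trans hy.2⟩

theorem sq_integral_abs_le_integral_sq {φ : ℝ → ℝ} (hφ : ContinuousOn φ (Icc (0:ℝ) 1)) :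
    (∫ z in (0:ℝ)..1, |φ z|) ^ 2 ≤ ∫ z in (0:ℝ)..1, φ z ^ 2 := by
  set A := ∫ z in (0:ℝ)..1, |φ z| with hA
  have hu : Set.uIcc (0:ℝ) 1 = Icc 0 1 := Set.uIcc_of_le zero_le_one
  have i1 : IntervalIntegrable (fun z => φ z ^ 2) volume 0 1 :=
    ContinuousOn.intervalIntegrable (by rw [hu]; exact hφ.pow 2)
  have i2 : IntervalIntegrable (fun z => |φ z|) volume 0 1 :=
    ContinuousOn.intervalIntegrable (by rw [hu]; exact hφ.abs)
  have h0 : 0 ≤ ∫ z in (0:ℝ)..1, (|φ z| - A) ^ 2 :=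
    intervalIntegral.integral_nonneg zero_le_one fun z _ => sq_nonneg _
  have h1 : ∫ z in (0:ℝ)..1, (|φ z| - A) ^ 2
      = (∫ z in (0:ℝ)..1, φ z ^ 2) - 2 * A * A + A ^ 2 := by
    have : ∀ z, (|φ z| - A) ^ 2 = φ z ^ 2 - 2 * A * |φ z| + A ^ 2 := by
      intro z; rw [← sq_abs (φ z)]; ring
    simp_rw [this]
    rw [intervalIntegral.integral_add (i1.sub (i2.const_mul _)) (by simp),
      intervalIntegral.integral_sub i1 (i2.const_mul _), intervalIntegral.integral_const_mul]
    simp [hA]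
  nlinarith

theorem sq_sub_le_integral_sq_deriv {f φ : ℝ → ℝ} (hf : ContinuousOn f (Icc (0:ℝ) 1))
    (hφ : ContinuousOn φ (Icc (0:ℝ) 1)) (hd : ∀ x ∈ Ioo (0:ℝ) 1, HasDerivAt f (φ x) x)
    {x y : ℝ} (hx : x ∈ Icc (0:ℝ) 1) (hy : y ∈ Icc (0:ℝ) 1) :
    (f x - f y) ^ 2 ≤ ∫ z in (0:ℝ)..1, φ z ^ 2 := by
  have hsub : Set.uIcc y x ⊆ Icc (0:ℝ) 1 := Set.uIcc_subset_Icc hy hx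
  have h1 : ∫ z in y..x, φ z = f x - f y := by
    apply intervalIntegral.integral_eq_sub_of_hasDeriv_right (hf.mono hsub)
    · intro z hz
      refine (hd z ⟨?_, ?_⟩).hasDerivWithinAt
      · exact (le_min hy.1 hx.1).trans_lt hz.1
      · exact hz.2.trans_le (max_le hy.2 hx.2)
    · exact (hφ.mono hsub).intervalIntegrable
  rw [← h1, ← sq_abs]
  exact (pow_le_pow_left₀ (abs_nonneg _) (abs_intervalIntegral_le_of_mem_unit hφ hx hy) 2).trans
    (sq_integral_abs_le_integral_sq hφ)

theorem integral_congr_Ioo {f g : ℝ → ℝ} {a b : ℝ} (hab : a ≤ b)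
    (h : ∀ x ∈ Ioo a b, f x = g x) : ∫ x in a..b, f x = ∫ x in a..b, g x := by
  rw [intervalIntegral.integral_of_le hab, intervalIntegral.integral_of_le hab,
    integral_Ioc_eq_integral_Ioo, integral_Ioc_eq_integral_Ioo]
  exact setIntegral_congr_fun measurableSet_Ioo h

/-- The embedding `H¹(0,1) ⊂ L∞(0,1)`. -/
theorem sq_le_two_mul_L2sq {f φ : ℝ → ℝ} (hf : ContinuousOn f (Icc (0:ℝ) 1))
    (hφ : ContinuousOn φ (Icc (0:ℝ) 1)) (hd : ∀ x ∈ Ioo (0:ℝ) 1, HasDerivAt f (φ x) x)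
    {x : ℝ} (hx : x ∈ Icc (0:ℝ) 1) :
    f x ^ 2 ≤ 2 * (L2sq f + L2sq (deriv f)) := by
  have e : L2sq (deriv f) = ∫ z in (0:ℝ)..1, φ z ^ 2 :=
    integral_congr_Ioo zero_le_one fun z hz => by rw [(hd z hz).deriv]
  have hu : Set.uIcc (0:ℝ) 1 = Icc 0 1 := Set.uIcc_of_le zero_le_one
  have i1 : IntervalIntegrable (fun z => f z ^ 2) volume 0 1 :=
    ContinuousOn.intervalIntegrable (by rw [hu]; exact hf.pow 2)
  have h : ∫ y in (0:ℝ)..1, f x ^ 2 ≤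
      ∫ y in (0:ℝ)..1, (2 * f y ^ 2 + 2 * ∫ z in (0:ℝ)..1, φ z ^ 2) := by
    refine intervalIntegral.integral_mono_on zero_le_one (by simp)
      ((i1.const_mul 2).add (by simp)) fun y hy => ?_
    nlinarith [sq_sub_le_integral_sq_deriv hf hφ hd hx hy, sq_nonneg (f x - 2 * f y)]
  rw [intervalIntegral.integral_add (i1.const_mul 2) (by simp),
    intervalIntegral.integral_const_mul] at h
  simp only [intervalIntegral.integral_const, sub_zero, one_smul] at h
  rw [e, L2sq]
  linarith

theorem L2sq_nonneg (f : ℝ → ℝ) : 0 ≤ L2sq f :=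
  intervalIntegral.integral_nonneg zero_le_one fun _ _ => sq_nonneg _

theorem L2sq_add_le_sobSq {k i : ℕ} (hi : i + 1 ≤ k) (f : ℝ → ℝ) :
    L2sq (iteratedDeriv i f) + L2sq (iteratedDeriv (i + 1) f) ≤ sobSq k f := by
  unfold sobSq
  rw [← Finset.sum_pair (f := fun j => L2sq (iteratedDeriv j f)) (Nat.succ_ne_self i).symm]
  refine Finset.sum_le_sum_of_subset_of_nonneg ?_ fun _ _ _ => L2sq_nonneg _
  intro j hj
  simp only [Finset.mem_insert, Finset.mem_singleton, Finset.mem_range] at hj ⊢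
  omega

theorem sobSq_nonneg (k : ℕ) (f : ℝ → ℝ) : 0 ≤ sobSq k f :=
  Finset.sum_nonneg fun _ _ => L2sq_nonneg _

theorem sq_iteratedDeriv_le_sobSq {k i : ℕ} {f : ℝ → ℝ} (hf : ContDiff ℝ k f) (hi : i + 1 ≤ k)
    {x : ℝ} (hx : x ∈ Icc (0:ℝ) 1) : iteratedDeriv i f x ^ 2 ≤ 2 * sobSq k f := by
  have h := sq_le_two_mul_L2sq (f := iteratedDeriv i f) (φ := iteratedDeriv (i + 1) f)
    (hf.continuous_iteratedDeriv i (by exact_mod_cast (by omega : i ≤ k))).continuousOn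
    (hf.continuous_iteratedDeriv (i + 1) (by exact_mod_cast hi)).continuousOn
    (fun z _ => by
      rw [iteratedDeriv_succ]
      exact (hf.differentiable_iteratedDeriv i
        (by exact_mod_cast (by omega : i < k)) z).hasDerivAt) hx
  rw [← iteratedDeriv_succ] at h
  linarith [L2sq_add_le_sobSq hi f]

theorem ContDiffOn.hasDerivAt_derivWithin_unit {n : ℕ} {f : ℝ → ℝ}
    (hf : ContDiffOn ℝ (n + 1) f (Icc (0:ℝ) 1)) {x : ℝ} (hx : x ∈ Ioo (0:ℝ) 1) :
    HasDerivAt f (derivWithin f (Icc 0 1) x) x := by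
  have h1 : DifferentiableWithinAt ℝ f (Icc 0 1) x :=
    (hf.differentiableOn (by simp)) x (Ioo_subset_Icc_self hx)
  exact h1.hasDerivWithinAt.hasDerivAt (Icc_mem_nhds hx.1 hx.2)

theorem sq_le_sobSq_of_contDiffOn {k : ℕ} (hk : 1 ≤ k) {f : ℝ → ℝ}
    (hf : ContDiffOn ℝ 1 f (Icc (0:ℝ) 1)) {x : ℝ} (hx : x ∈ Icc (0:ℝ) 1) :
    f x ^ 2 ≤ 2 * sobSq k f := by
  have h := sq_le_two_mul_L2sq (f := f) hf.continuousOn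
    (hf.continuousOn_derivWithin (uniqueDiffOn_Icc zero_lt_one) le_rfl)
    (fun z hz => ContDiffOn.hasDerivAt_derivWithin_unit (n := 0) (by simpa using hf) hz) hx
  have h2 := L2sq_add_le_sobSq (i := 0) hk f
  rw [zero_add, iteratedDeriv_zero, iteratedDeriv_one] at h2
  linarith

theorem L2sq_congr_Ioo {f g : ℝ → ℝ} (h : ∀ x ∈ Ioo (0:ℝ) 1, f x = g x) : L2sq f = L2sq g :=
  integral_congr_Ioo zero_le_one fun x hx => by rw [h x hx]

theorem abs_sub_le_sobSq_of_contDiffOn {f : ℝ → ℝ} (hf : ContDiffOn ℝ 2 f (Icc (0:ℝ) 1))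
    {x y : ℝ} (hx : x ∈ Icc (0:ℝ) 1) (hy : y ∈ Icc (0:ℝ) 1) :
    |f x - f y| ≤ (1 + 2 * sobSq 2 f) * |x - y| := by
  set φ := derivWithin f (Icc 0 1) with hφ
  have hφ1 : ContDiffOn ℝ 1 φ (Icc (0:ℝ) 1) :=
    hf.derivWithin (uniqueDiffOn_Icc zero_lt_one) (by norm_num)
  have hd : ∀ z ∈ Ioo (0:ℝ) 1, HasDerivAt f (φ z) z := fun z hz =>
    ContDiffOn.hasDerivAt_derivWithin_unit (n := 1)
      (by have : ((1:ℕ) + 1 : WithTop ℕ∞) = 2 := by norm_num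
          rw [this]; exact hf) hz
  have key : ∀ z ∈ Icc (0:ℝ) 1, φ z ^ 2 ≤ 2 * sobSq 2 f := by
    intro z hz
    have h := sq_le_two_mul_L2sq (f := φ) hφ1.continuousOn
      (hφ1.continuousOn_derivWithin (uniqueDiffOn_Icc zero_lt_one) le_rfl)
      (fun z hz => ContDiffOn.hasDerivAt_derivWithin_unit (n := 0) (by simpa using hφ1) hz) hz
    have h2 := L2sq_add_le_sobSq (i := 1) (k := 2) le_rfl f
    have e1 : L2sq (iteratedDeriv 1 f) = L2sq φ := L2sq_congr_Ioo fun z hz => by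
      rw [iteratedDeriv_one, (hd z hz).deriv]
    have e2 : L2sq (iteratedDeriv (1 + 1) f) = L2sq (deriv φ) := L2sq_congr_Ioo fun z hz => by
      rw [iteratedDeriv_succ, iteratedDeriv_one]
      refine Filter.EventuallyEq.deriv_eq ?_
      filter_upwards [Ioo_mem_nhds hz.1 hz.2] with w hw using (hd w hw).deriv
    linarith
  have hb : ∀ z ∈ Icc (0:ℝ) 1, ‖φ z‖ ≤ 1 + 2 * sobSq 2 f := by
    intro z hz
    rw [Real.norm_eq_abs]
    nlinarith [key z hz, sq_abs (φ z), abs_nonneg (φ z), sq_nonneg (|φ z| - 1)]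
  have := (convex_Icc (0:ℝ) 1).norm_image_sub_le_of_norm_hasDerivWithin_le
    (f := f) (f' := φ) (C := 1 + 2 * sobSq 2 f)
    (fun z hz => ((hf.differentiableOn (by norm_num)) z hz).hasDerivWithinAt) hb hy hx
  simpa [Real.norm_eq_abs] using this

theorem abs_le_one_add_of_sq_le {a b : ℝ} (h : a ^ 2 ≤ b) : |a| ≤ 1 + b := by
  nlinarith [sq_abs a, abs_nonneg a, sq_nonneg (|a| - 1)]

theorem abs_sub_le_integral_of_abs_deriv_le {f k : ℝ → ℝ} {T : ℝ}
    (hk : IntervalIntegrable k volume 0 T)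
    (hd : ∀ t ∈ Icc (0:ℝ) T, DifferentiableAt ℝ f t)
    (hb : ∀ t ∈ Icc (0:ℝ) T, |deriv f t| ≤ k t)
    {s t : ℝ} (hs : 0 ≤ s) (hst : s ≤ t) (ht : t ≤ T) :
    |f t - f s| ≤ ∫ r in s..t, k r := by
  have hsub : Icc s t ⊆ Icc 0 T := Icc_subset_Icc hs ht
  have hk' : IntervalIntegrable k volume s t :=
    hk.mono_set (by
      rw [Set.uIcc_of_le hst, Set.uIcc_of_le (hs.trans (hst.trans ht))]; exact hsub)
  have hintegral : IntervalIntegrable (deriv f) volume s t := by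
    refine hk'.mono_fun (measurable_deriv f).aestronglyMeasurable ?_
    rw [EventuallyLE, ae_restrict_iff' measurableSet_uIoc]
    refine ae_of_all _ fun r hr => ?_
    rw [Set.uIoc_of_le hst] at hr
    rw [Real.norm_eq_abs, Real.norm_eq_abs]
    exact (hb r (hsub (Ioc_subset_Icc_self hr))).trans (le_abs_self _)
  rw [← intervalIntegral.integral_eq_sub_of_hasDerivAt (f' := deriv f)
    (fun r hr => (hd r (hsub (by rwa [Set.uIcc_of_le hst] at hr))).hasDerivAt) hintegral]
  have h := intervalIntegral.norm_integral_le_of_norm_le (f := deriv f) (g := k) hst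
    (ae_of_all _ fun r hr => by
      rw [Real.norm_eq_abs]; exact hb r (hsub (Ioc_subset_Icc_self hr))) hk'
  simpa [Real.norm_eq_abs] using h

theorem abs_sub_le_abs_primitive_sub {f k : ℝ → ℝ} {T : ℝ}
    (hk : IntervalIntegrable k volume 0 T)
    (hd : ∀ t ∈ Icc (0:ℝ) T, DifferentiableAt ℝ f t)
    (hb : ∀ t ∈ Icc (0:ℝ) T, |deriv f t| ≤ k t)
    {s t : ℝ} (hs : s ∈ Icc (0:ℝ) T) (ht : t ∈ Icc (0:ℝ) T) :
    |f t - f s| ≤ |(∫ r in (0:ℝ)..t, k r) - ∫ r in (0:ℝ)..s, k r| := by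
  wlog hst : s ≤ t generalizing s t
  · rw [abs_sub_comm, abs_sub_comm (∫ r in (0:ℝ)..t, k r)]
    exact this ht hs (le_of_not_ge hst)
  have hT : (0:ℝ) ≤ T := hs.1.trans hs.2
  have hi : ∀ r ∈ Icc (0:ℝ) T, IntervalIntegrable k volume 0 r := fun r hr =>
    hk.mono_set (by
      rw [Set.uIcc_of_le hr.1, Set.uIcc_of_le hT]; exact Icc_subset_Icc_right hr.2)
  rw [intervalIntegral.integral_interval_sub_left (hi t ht) (hi s hs)]
  exact (abs_sub_le_integral_of_abs_deriv_le hk hd hb hs.1 hst ht.2).trans (le_abs_self _)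

/-- Uniform-in-`x` Lipschitz control of the time derivative gives control of the spatial
derivative. -/
theorem abs_deriv_sub_le_abs_primitive_sub {u : ℝ → ℝ → ℝ} {k : ℝ → ℝ} {T : ℝ}
    (hk : IntervalIntegrable k volume 0 T)
    (hd : ∀ t ∈ Icc (0:ℝ) T, ∀ x ∈ Icc (0:ℝ) 1, DifferentiableAt ℝ (fun s => u s x) t)
    (hb : ∀ t ∈ Icc (0:ℝ) T, ∀ x ∈ Icc (0:ℝ) 1, ∀ y ∈ Icc (0:ℝ) 1,
      |tderiv u t x - tderiv u t y| ≤ k t * |x - y|)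
    (hx : ∀ t ∈ Icc (0:ℝ) T, ContDiff ℝ 1 (u t))
    {s t : ℝ} (hs : s ∈ Icc (0:ℝ) T) (ht : t ∈ Icc (0:ℝ) T) {x : ℝ} (hx1 : x ∈ Icc (0:ℝ) 1) :
    |deriv (u t) x - deriv (u s) x|
      ≤ |(∫ r in (0:ℝ)..t, k r) - ∫ r in (0:ℝ)..s, k r| := by
  set C := |(∫ r in (0:ℝ)..t, k r) - ∫ r in (0:ℝ)..s, k r| with hC
  have hdu : ∀ r ∈ Icc (0:ℝ) T, ∀ y, HasDerivAt (u r) (deriv (u r) y) y := fun r hr y =>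
    ((hx r hr).differentiable (by norm_num) y).hasDerivAt
  have hlip : ∀ z ∈ Icc (0:ℝ) 1, ∀ y ∈ Icc (0:ℝ) 1,
      |(u t z - u s z) - (u t y - u s y)| ≤ C * |z - y| := by
    intro z hz y hy
    have h := abs_sub_le_abs_primitive_sub (f := fun r => u r z - u r y)
      (k := fun r => k r * |z - y|) (hk.mul_const _)
      (fun r hr => (hd r hr z hz).sub (hd r hr y hy))
      (fun r hr => by
        have := hb r hr z hz y hy
        rw [tderiv, tderiv] at this
        rwa [deriv_fun_sub (hd r hr z hz) (hd r hr y hy)]) hs ht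
    rw [intervalIntegral.integral_mul_const, intervalIntegral.integral_mul_const, ← sub_mul,
      abs_mul, abs_abs, ← hC] at h
    convert h using 2
    ring
  have hcl : ∀ y ∈ Ioo (0:ℝ) 1, |deriv (u t) y - deriv (u s) y| ≤ C := by
    intro y hy
    have hder : HasDerivAt (fun z => u t z - u s z) (deriv (u t) y - deriv (u s) y) y :=
      (hdu t ht y).sub (hdu s hs y)
    have := hder.le_of_lip' (C := C) (abs_nonneg _) (by
      filter_upwards [Icc_mem_nhds hy.1 hy.2] with z hz
      have := hlip z hz y (Ioo_subset_Icc_self hy)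
      rw [Real.norm_eq_abs, Real.norm_eq_abs]
      exact this)
    simpa [Real.norm_eq_abs] using this
  have hcont : Continuous fun y => |deriv (u t) y - deriv (u s) y| :=
    (((hx t ht).continuous_deriv le_rfl).sub ((hx s hs).continuous_deriv le_rfl)).abs
  have hclosed : IsClosed {y | |deriv (u t) y - deriv (u s) y| ≤ C} :=
    isClosed_le hcont continuous_const
  have := closure_minimal (fun y hy => hcl y hy) hclosed
  rw [closure_Ioo (by norm_num)] at this
  exact this hx1

theorem AbsolutelyContinuousOnInterval.of_abs_sub_le {F G : ℝ → ℝ} {a b C : ℝ}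
    (hG : AbsolutelyContinuousOnInterval G a b)
    (h : ∀ s ∈ uIcc a b, ∀ t ∈ uIcc a b, |F t - F s| ≤ C * |G t - G s|) :
    AbsolutelyContinuousOnInterval F a b := by
  rw [absolutelyContinuousOnInterval_iff] at hG ⊢
  intro ε hε
  obtain ⟨δ, hδ, H⟩ := hG (ε / (|C| + 1)) (by positivity)
  refine ⟨δ, hδ, fun E hE hlen => ?_⟩
  have h1 := H E hE hlen
  have hmem : ∀ i ∈ Finset.range E.1, (E.2 i).1 ∈ uIcc a b ∧ (E.2 i).2 ∈ uIcc a b := hE.1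
  calc ∑ i ∈ Finset.range E.1, dist (F (E.2 i).1) (F (E.2 i).2)
      ≤ ∑ i ∈ Finset.range E.1, (|C| + 1) * dist (G (E.2 i).1) (G (E.2 i).2) := by
        refine Finset.sum_le_sum fun i hi => ?_
        rw [Real.dist_eq, Real.dist_eq]
        refine (h _ (hmem i hi).2 _ (hmem i hi).1).trans ?_
        exact mul_le_mul_of_nonneg_right ((le_abs_self C).trans (by linarith)) (abs_nonneg _)
    _ = (|C| + 1) * ∑ i ∈ Finset.range E.1, dist (G (E.2 i).1) (G (E.2 i).2) := by
        rw [Finset.mul_sum]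
    _ < (|C| + 1) * (ε / (|C| + 1)) := by gcongr
    _ = ε := by field_simp

/-- Grönwall's inequality for absolutely continuous functions with an integrable coefficient. -/
theorem nonpos_of_ae_hasDerivAt_le {F K : ℝ → ℝ} {T : ℝ}
    (hK : IntervalIntegrable K volume 0 T) (hK0 : ∀ t ∈ Icc (0:ℝ) T, 0 ≤ K t)
    (hF : AbsolutelyContinuousOnInterval F 0 T) (hF0 : F 0 ≤ 0)
    (hd : ∀ᵐ t, t ∈ Ioo (0:ℝ) T → ∃ F', HasDerivAt F F' t ∧ F' ≤ K t * F t)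
    {t : ℝ} (ht : t ∈ Icc (0:ℝ) T) : F t ≤ 0 := by
  have hT : (0:ℝ) ≤ T := ht.1.trans ht.2
  set Γ : ℝ → ℝ := fun s => ∫ r in (0:ℝ)..s, K r with hΓ
  have hΓac : AbsolutelyContinuousOnInterval Γ 0 T :=
    hK.absolutelyContinuousOnInterval_intervalIntegral (by simp)
  have hΓ0 : ∀ s ∈ Icc (0:ℝ) T, 0 ≤ Γ s := fun s hs =>
    intervalIntegral.integral_nonneg hs.1 fun r hr => hK0 r ⟨hr.1, hr.2.trans hs.2⟩
  have hexp : AbsolutelyContinuousOnInterval (fun s => Real.exp (-Γ s)) 0 T := by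
    refine hΓac.of_abs_sub_le (C := 1) fun s hs r hr => ?_
    rw [Set.uIcc_of_le hT] at hs hr
    have key : ∀ a b : ℝ, 0 ≤ a → 0 ≤ b → Real.exp (-a) - Real.exp (-b) ≤ |a - b| := by
      intro a b ha hb
      rcases le_total a b with hab | hab
      · have h1 : Real.exp (-b) = Real.exp (-a) * Real.exp (a - b) := by
          rw [← Real.exp_add]; ring_nf
        have h2 := Real.add_one_le_exp (a - b)
        have h3 : Real.exp (-a) ≤ 1 := Real.exp_le_one_iff.2 (by linarith)
        have h4 := Real.exp_pos (-a)
        rw [abs_of_nonpos (by linarith), h1]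
        nlinarith
      · have := Real.exp_le_exp.2 (neg_le_neg hab)
        linarith [abs_nonneg (a - b)]
    rw [one_mul, abs_le]
    have h1 := key _ _ (hΓ0 s hs) (hΓ0 r hr)
    have h2 := key _ _ (hΓ0 r hr) (hΓ0 s hs)
    rw [abs_sub_comm] at h1
    constructor <;> linarith
  have hprod := (hF.fun_mul hexp).mono (c := 0) (d := t)
    (by rw [Set.uIcc_of_le ht.1, Set.uIcc_of_le hT]; exact Icc_subset_Icc_right ht.2)
  have hintegral := hprod.integral_deriv_eq_sub
  have hle : ∫ s in (0:ℝ)..t, deriv (fun s => F s * Real.exp (-Γ s)) s ≤ 0 := by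
    rw [← neg_nonneg, ← intervalIntegral.integral_neg]
    refine intervalIntegral.integral_nonneg_of_ae_restrict ht.1 ?_
    rw [EventuallyLE, ae_restrict_iff' measurableSet_Icc]
    have h0 : ∀ᵐ s : ℝ, s ≠ 0 := by simp [ae_iff, measure_singleton]
    have h1 : ∀ᵐ s : ℝ, s ≠ T := by simp [ae_iff, measure_singleton]
    filter_upwards [hd, hK.ae_hasDerivAt_integral, h0, h1] with s hs hs' hs0 hsT hst
    have hs2 : s ≤ T := hst.2.trans ht.2
    obtain ⟨F', hF', hle⟩ := hs ⟨lt_of_le_of_ne hst.1 (Ne.symm hs0), lt_of_le_of_ne hs2 hsT⟩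
    have hΓd : HasDerivAt Γ (K s) s :=
      hs' (by rw [Set.uIcc_of_le hT]; exact ⟨hst.1, hs2⟩) 0 (by simp)
    rw [(hF'.fun_mul hΓd.fun_neg.exp).deriv]
    have := Real.exp_pos (-Γ s)
    simp only [Pi.zero_apply]
    nlinarith
  rw [hintegral] at hle
  have : Γ 0 = 0 := by simp [hΓ]
  simp only [this] at hle
  simp only [neg_zero, Real.exp_zero, mul_one] at hle
  have h5 := Real.exp_pos (-Γ t)
  by_contra hcon
  push Not at hcon
  nlinarith [mul_pos hcon h5]

/-- Differentiation under the integral sign at a point where the functions are dominated by the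
increments of a differentiable function. -/
theorem hasDerivAt_integral_of_abs_sub_le {w : ℝ → ℝ → ℝ} {w' G : ℝ → ℝ} {C g T t : ℝ}
    (hw : ∀ s ∈ Icc (0:ℝ) T, ContinuousOn (w s) (Icc (0:ℝ) 1))
    (hlip : ∀ s ∈ Icc (0:ℝ) T, ∀ x ∈ Icc (0:ℝ) 1, |w s x - w t x| ≤ C * |G s - G t|)
    (ht : t ∈ Ioo (0:ℝ) T) (hG : HasDerivAt G g t)
    (hd : ∀ x ∈ Icc (0:ℝ) 1, HasDerivAt (fun s => w s x) (w' x) t)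
    (hw' : ContinuousOn w' (Icc (0:ℝ) 1)) :
    HasDerivAt (fun s => ∫ x in (0:ℝ)..1, w s x) (∫ x in (0:ℝ)..1, w' x) t := by
  have hev : ∀ᶠ s in 𝓝 t, s ∈ Icc (0:ℝ) T ∧ |G s - G t| ≤ (|g| + 1) * |s - t| := by
    refine Filter.Eventually.and (Icc_mem_nhds ht.1 ht.2) ?_
    have h1 := (hasDerivAt_iff_isLittleO.1 hG).def zero_lt_one
    filter_upwards [h1] with s hs
    simp only [Real.norm_eq_abs, smul_eq_mul, one_mul] at hs
    have h2 : |G s - G t| ≤ |G s - G t - (s - t) * g| + |(s - t) * g| := by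
      have := abs_add_le (G s - G t - (s - t) * g) ((s - t) * g)
      simpa using this
    rw [abs_mul] at h2
    nlinarith
  have hIoc : Ioc (0:ℝ) 1 ⊆ Icc 0 1 := Ioc_subset_Icc_self
  have htT : t ∈ Icc (0:ℝ) T := Ioo_subset_Icc_self ht
  set μ : Measure ℝ := volume.restrict (Ioc (0:ℝ) 1) with hμ
  have hmeas : ∀ f : ℝ → ℝ, ContinuousOn f (Icc (0:ℝ) 1) → AEStronglyMeasurable f μ := fun f hf =>
    (hf.mono hIoc).aestronglyMeasurable measurableSet_Ioc
  have hF := hasFDerivAt_integral_of_dominated_loc_of_lip' (𝕜 := ℝ) (μ := μ) (F := w)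
    (F' := fun x => ContinuousLinearMap.toSpanSingleton ℝ (w' x)) (x₀ := t)
    (bound := fun _ => |C| * (|g| + 1)) hev
    (fun s hs => hmeas _ (hw s hs.1))
    ((hw t htT).integrableOn_Icc.mono_set hIoc)
    ((ContinuousLinearMap.toSpanSingletonCLE (𝕜 := ℝ) (E := ℝ)).continuous.comp_aestronglyMeasurable (hmeas _ hw'))
    (by
      rw [hμ, ae_restrict_iff' measurableSet_Ioc]
      refine ae_of_all _ fun x hx s hs => ?_
      rw [Real.norm_eq_abs, Real.norm_eq_abs]
      have h1 := hlip s hs.1 x (hIoc hx)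
      have h2 := mul_le_mul_of_nonneg_right (le_abs_self C) (abs_nonneg (G s - G t))
      have h3 := mul_le_mul_of_nonneg_left hs.2 (abs_nonneg C)
      linarith)
    (integrableOn_const (by simp))
    (by
      rw [hμ, ae_restrict_iff' measurableSet_Ioc]
      exact ae_of_all _ fun x hx => (hd x (hIoc hx)).hasFDerivAt)
  have h1 := hF.2.hasDerivAt
  rw [ContinuousLinearMap.integral_apply hF.1] at h1
  simp only [ContinuousLinearMap.toSpanSingleton_apply, one_smul] at h1
  simp only [intervalIntegral.integral_of_le zero_le_one]
  exact h1

theorem hasDerivAt_zero_of_abs_le_sq {c G : ℝ → ℝ} {g t : ℝ} (hG : HasDerivAt G g t)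
    (hc0 : c t = 0) (hc : ∀ᶠ s in 𝓝 t, |c s| ≤ (G s - G t) ^ 2) : HasDerivAt c 0 t := by
  have hsq : HasDerivAt (fun s => (G s - G t) ^ 2) 0 t := by
    have := (hG.sub_const (G t)).fun_pow 2
    simpa using this
  rw [hasDerivAt_iff_isLittleO] at hsq ⊢
  refine Asymptotics.IsBigO.trans_isLittleO ?_ hsq
  refine Asymptotics.IsBigO.of_bound 1 ?_
  filter_upwards [hc] with s hs
  simpa [hc0] using hs

/-- Two numbers bounded by `A` whose difference is bounded by `δ`. -/
def BddDiff (A δ a b : ℝ) : Prop := |a| ≤ A ∧ |b| ≤ A ∧ |a - b| ≤ δ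

theorem BddDiff.mul {A B δ η a b c d : ℝ} (h : BddDiff A δ a b) (h' : BddDiff B η c d) :
    BddDiff (A * B) (δ * B + A * η) (a * c) (b * d) := by
  obtain ⟨h1, h2, h3⟩ := h
  obtain ⟨h1', h2', h3'⟩ := h'
  have hA : 0 ≤ A := (abs_nonneg _).trans h1
  have hδ : 0 ≤ δ := (abs_nonneg _).trans h3
  refine ⟨?_, ?_, ?_⟩
  · rw [abs_mul]; exact mul_le_mul h1 h1' (abs_nonneg _) hA
  · rw [abs_mul]; exact mul_le_mul h2 h2' (abs_nonneg _) hA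
  · have e : a * c - b * d = (a - b) * c + b * (c - d) := by ring
    rw [e]
    refine (abs_add_le _ _).trans (add_le_add ?_ ?_)
    · rw [abs_mul]; exact mul_le_mul h3 h1' (abs_nonneg _) hδ
    · rw [abs_mul]; exact mul_le_mul h2 h3' (abs_nonneg _) hA

theorem BddDiff.inv {A δ a b : ℝ} (ha : 0 < a) (hb : 0 < b) (h1 : a⁻¹ ≤ A) (h2 : b⁻¹ ≤ A)
    (h : |a - b| ≤ δ) : BddDiff A (A ^ 2 * δ) a⁻¹ b⁻¹ := by
  have ha' := inv_pos.2 ha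
  have hb' := inv_pos.2 hb
  refine ⟨by rwa [abs_of_pos ha'], by rwa [abs_of_pos hb'], ?_⟩
  have e : a⁻¹ - b⁻¹ = (a⁻¹ * b⁻¹) * (b - a) := by field_simp
  rw [e, abs_mul, abs_of_pos (mul_pos ha' hb'), abs_sub_comm b a, pow_two]
  exact mul_le_mul (mul_le_mul h1 h2 hb'.le (ha'.le.trans h1)) h (abs_nonneg _)
    (mul_nonneg (ha'.le.trans h1) (ha'.le.trans h1))

theorem abs_flux_diff_le {M s X Y N₁ N₂ J₁ J₂ E₁ E₂ D₁ D₂ S₁ S₂ : ℝ} (hM : 1 ≤ M) (hs : 1 ≤ s)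
    (hN₁ : 0 < N₁) (hN₂ : 0 < N₂) (hi₁ : N₁⁻¹ ≤ M) (hi₂ : N₂⁻¹ ≤ M) (hN : |N₁ - N₂| ≤ X)
    (hJ : BddDiff M X J₁ J₂) (hE : BddDiff M X E₁ E₂) (hD : BddDiff M X D₁ D₂)
    (hS : BddDiff s Y S₁ S₂) :
    |J₁ ^ 2 / N₁ - J₂ ^ 2 / N₂| ≤ 20 * M ^ 6 * X ∧
    |J₁ / N₁ * E₁ - J₂ / N₂ * E₂| ≤ 20 * M ^ 6 * X ∧
    |J₁ ^ 3 / N₁ ^ 2 - J₂ ^ 3 / N₂ ^ 2| ≤ 20 * M ^ 6 * X ∧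
    |(J₁ * S₁ / N₁ - J₁ * D₁ ^ 2 / N₁ ^ 2) - (J₂ * S₂ / N₂ - J₂ * D₂ ^ 2 / N₂ ^ 2)|
      ≤ 20 * M ^ 6 * (s * X + Y) ∧
    |(2 * D₁ * S₁ / N₁ - D₁ ^ 3 / N₁) - (2 * D₂ * S₂ / N₂ - D₂ ^ 3 / N₂)|
      ≤ 20 * M ^ 6 * (s * X + Y) := by
  have hw := BddDiff.inv hN₁ hN₂ hi₁ hi₂ hN
  have hX : 0 ≤ X := (abs_nonneg _).trans hN
  have hY : 0 ≤ Y := (abs_nonneg _).trans hS.2.2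
  have hp : ∀ k ≤ 6, M ^ k ≤ M ^ 6 := fun k hk => pow_le_pow_right₀ hM hk
  have h1 := hp 1 (by norm_num)
  have h2 := hp 2 (by norm_num)
  have h3 := hp 3 (by norm_num)
  have h4 := hp 4 (by norm_num)
  have h5 := hp 5 (by norm_num)
  have h0 := hp 0 (by norm_num)
  have hXs : X ≤ s * X := by nlinarith
  have hMX : 0 ≤ M ^ 6 * X := by positivity
  have hMX2 : M ^ 6 * X ≤ M ^ 6 * (s * X) := by gcongr
  have hsX : 0 ≤ s * X := hX.trans hXs
  have g : ∀ k ≤ 6, M ^ k * X ≤ M ^ 6 * X := fun k hk => by have := hp k hk; gcongr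
  have gs : ∀ k ≤ 6, M ^ k * (s * X) ≤ M ^ 6 * (s * X) := fun k hk => by have := hp k hk; gcongr
  have gY : ∀ k ≤ 6, M ^ k * Y ≤ M ^ 6 * Y := fun k hk => by have := hp k hk; gcongr
  have g2 := g 2 (by norm_num)
  have g3 := g 3 (by norm_num)
  have g4 := g 4 (by norm_num)
  have g5 := g 5 (by norm_num)
  have gs1 := gs 1 (by norm_num)
  have gs3 := gs 3 (by norm_num)
  have gY2 := gY 2 (by norm_num)
  have gY0 : 0 ≤ M ^ 6 * Y := by positivity
  have cube := (hJ.mul (hJ.mul hJ)).mul (hw.mul hw)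
  have mix := (hJ.mul (hD.mul hD)).mul (hw.mul hw)
  have high := (hJ.mul hS).mul hw
  have high' := (hD.mul hS).mul hw
  have dcube := (hD.mul (hD.mul hD)).mul hw
  refine ⟨?_, ?_, ?_, ?_, ?_⟩
  · have h := ((hJ.mul hJ).mul hw).2.2
    have e : J₁ ^ 2 / N₁ - J₂ ^ 2 / N₂ = J₁ * J₁ * N₁⁻¹ - J₂ * J₂ * N₂⁻¹ := by
      simp only [div_eq_mul_inv]; ring
    rw [e]; refine h.trans ?_
    nlinarith
  · have h := ((hJ.mul hw).mul hE).2.2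
    have e : J₁ / N₁ * E₁ - J₂ / N₂ * E₂ = J₁ * N₁⁻¹ * E₁ - J₂ * N₂⁻¹ * E₂ := by
      simp only [div_eq_mul_inv]
    rw [e]; refine h.trans ?_
    nlinarith
  · have e : J₁ ^ 3 / N₁ ^ 2 - J₂ ^ 3 / N₂ ^ 2
        = J₁ * (J₁ * J₁) * (N₁⁻¹ * N₁⁻¹) - J₂ * (J₂ * J₂) * (N₂⁻¹ * N₂⁻¹) := by
      simp only [div_eq_mul_inv, ← inv_pow]; ring
    rw [e]; refine cube.2.2.trans ?_
    nlinarith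
  · have e : (J₁ * S₁ / N₁ - J₁ * D₁ ^ 2 / N₁ ^ 2) - (J₂ * S₂ / N₂ - J₂ * D₂ ^ 2 / N₂ ^ 2)
        = (J₁ * S₁ * N₁⁻¹ - J₂ * S₂ * N₂⁻¹)
          - (J₁ * (D₁ * D₁) * (N₁⁻¹ * N₁⁻¹) - J₂ * (D₂ * D₂) * (N₂⁻¹ * N₂⁻¹)) := by
      simp only [div_eq_mul_inv, ← inv_pow]; ring
    rw [e]; refine (abs_sub _ _).trans ((add_le_add high.2.2 mix.2.2).trans ?_)
    nlinarith
  · have e : (2 * D₁ * S₁ / N₁ - D₁ ^ 3 / N₁) - (2 * D₂ * S₂ / N₂ - D₂ ^ 3 / N₂)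
        = 2 * (D₁ * S₁ * N₁⁻¹ - D₂ * S₂ * N₂⁻¹)
          - (D₁ * (D₁ * D₁) * N₁⁻¹ - D₂ * (D₂ * D₂) * N₂⁻¹) := by
      simp only [div_eq_mul_inv]; ring
    rw [e]; refine (abs_sub _ _).trans ?_
    rw [abs_mul, abs_of_pos (by norm_num : (0:ℝ) < 2)]
    refine (add_le_add (mul_le_mul_of_nonneg_left high'.2.2 (by norm_num)) dcube.2.2).trans ?_
    nlinarith

theorem abs_mul_le_of_abs_le {a b A B : ℝ} (ha : |a| ≤ A) (hb : |b| ≤ B) : |a * b| ≤ A * B := by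
  rw [abs_mul]
  exact mul_le_mul ha hb (abs_nonneg _) ((abs_nonneg _).trans ha)

/-- Absorption of the flux terms by the parabolic dissipation. -/
theorem absorb_le {ν κ a c s X Q W Z : ℝ} (hν : 0 < ν) (hκ : 0 < κ) (ha : 0 < a)
    (hac : a * c ^ 2 ≤ κ * ν ^ 2) (hc : 0 ≤ c) (hs : 1 ≤ s) :
    -(κ * ν * Z ^ 2) - ν * Q ^ 2 - a * ν * W ^ 2 + c * s * X * (Q + W + Z + X) + a * c * (W * Z)
      ≤ (c ^ 2 / (4 * ν) + c ^ 2 / (2 * (a * ν)) + c ^ 2 / (2 * (κ * ν)) + c) * (s ^ 2 * X ^ 2) := by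
  have y : ∀ d u v : ℝ, 0 < d → u * v ≤ d * v ^ 2 + u ^ 2 / (4 * d) := by
    intro d u v hd
    have : d * v ^ 2 + u ^ 2 / (4 * d) - u * v = (2 * d * v - u) ^ 2 / (4 * d) := by
      field_simp; ring
    have h2 : 0 ≤ (2 * d * v - u) ^ 2 / (4 * d) := by positivity
    linarith
  have h1 := y ν (c * s * X) Q hν
  have h2 := y (a * ν / 2) (c * s * X) W (by positivity)
  have h3 := y (κ * ν / 2) (c * s * X) Z (by positivity)
  have h4 := y (a * ν / 2) (a * c * Z) W (by positivity)
  have h5 : (a * c * Z) ^ 2 / (4 * (a * ν / 2)) ≤ κ * ν / 2 * Z ^ 2 := by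
    rw [div_le_iff₀ (by positivity)]
    have : (a * c * Z) ^ 2 = a * (a * c ^ 2) * Z ^ 2 := by ring
    rw [this]
    have : κ * ν / 2 * Z ^ 2 * (4 * (a * ν / 2)) = a * (κ * ν ^ 2) * Z ^ 2 := by ring
    rw [this]
    gcongr
  have h6 : c * s * X * X ≤ c * (s ^ 2 * X ^ 2) := by
    have : s ≤ s ^ 2 := by nlinarith
    have : c * X ^ 2 * s ≤ c * X ^ 2 * s ^ 2 := by gcongr
    nlinarith
  have e1 : (c * s * X) ^ 2 / (4 * ν) = c ^ 2 / (4 * ν) * (s ^ 2 * X ^ 2) := by ring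
  have e2 : (c * s * X) ^ 2 / (4 * (a * ν / 2)) = c ^ 2 / (2 * (a * ν)) * (s ^ 2 * X ^ 2) := by
    field_simp; ring
  have e3 : (c * s * X) ^ 2 / (4 * (κ * ν / 2)) = c ^ 2 / (2 * (κ * ν)) * (s ^ 2 * X ^ 2) := by
    field_simp; ring
  rw [e1] at h1
  rw [e2] at h2
  rw [e3] at h3
  nlinarith

/-- The pointwise estimate of the terms that remain in the energy identity once the exact
derivatives have been split off. -/
theorem remainder_le {ν κ τ μ a c s X p px pxx q qx e ex vx nst Jst Vst dA dP dQ dR dS dF dG : ℝ}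
    (hν : 0 < ν) (hκ : 0 < κ) (hτ : 0 < τ) (hμ : 0 < μ) (ha : 0 < a) (ha1 : a ≤ 1)
    (hc : 1 ≤ c) (hs : 1 ≤ s) (hκc : κ ≤ c) (hτc : 1 / τ ≤ c) (hμc : μ ≤ c)
    (hp : |p| ≤ X) (hpx : |px| ≤ X) (hq : |q| ≤ X) (he : |e| ≤ X) (hvx : |vx| ≤ X)
    (hnst : |nst| ≤ c) (hJst : |Jst| ≤ c) (hVst : |Vst| ≤ c)
    (hA : |dA| ≤ c * (s * X + |pxx|)) (hP : |dP| ≤ c * X) (hQ : |dQ| ≤ c * X)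
    (hR : |dR| ≤ c * X) (hS : |dS| ≤ c * (s * X + |pxx|)) (hF : |dF| ≤ c * X)
    (hG : |dG| ≤ c * X) :
    -(ν * px ^ 2) - p * qx - κ * ν * pxx ^ 2 - ν * qx ^ 2 - q ^ 2 / τ - 2 / 3 * (q * ex)
      + nst * (q * vx) - μ * (q * px) - κ * (q * dA) + Vst * (q * p) + q * dF
      + 2 / 3 * (qx * dP) - a * ν * ex ^ 2
      + a * (-(2 / τ) * e ^ 2 + 3 / τ * (e * p) - (μ + 5 / 2) * (e * qx) + Vst * (e * q)
        + e * dG + Jst * (e * vx))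
      - a * (-(5 / 3) * (ex * dQ) + 1 / 3 * (ex * dR) + κ * (ex * dS))
    ≤ -(κ * ν * |pxx| ^ 2) - ν * |qx| ^ 2 - a * ν * |ex| ^ 2
      + (30 * c ^ 2) * s * X * (|qx| + |ex| + |pxx| + X) + a * (30 * c ^ 2) * (|ex| * |pxx|) := by
  have hX : 0 ≤ X := (abs_nonneg _).trans hp
  have hcX : 0 ≤ c * X := by positivity
  have hQx := abs_nonneg qx
  have hEx := abs_nonneg ex
  have hPx := abs_nonneg pxx
  have mle : ∀ {u v U V : ℝ}, |u| ≤ U → |v| ≤ V → |u * v| ≤ U * V :=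
    fun h h' => abs_mul_le_of_abs_le h h'
  have up : ∀ {u U : ℝ}, |u| ≤ U → u ≤ U := fun h => (le_abs_self _).trans h
  have dn : ∀ {u U : ℝ}, |u| ≤ U → -u ≤ U := fun h => (neg_le_abs _).trans h
  have hκa : |κ| ≤ c := by rwa [abs_of_pos hκ]
  have hμa : |μ| ≤ c := by rwa [abs_of_pos hμ]
  have haa : |a| ≤ 1 := by rwa [abs_of_pos ha]
  have haa' : |a| ≤ a := (abs_of_pos ha).le
  have hτa : |3 / τ| ≤ 3 * c := by
    rw [abs_of_pos (by positivity)]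
    have : 3 / τ = 3 * (1 / τ) := by ring
    linarith
  have hμ5 : |μ + 5 / 2| ≤ 4 * c := by rw [abs_of_pos (by positivity)]; linarith
  have t1 := dn (mle hp (le_refl |qx|))
  have t2 : 0 ≤ q ^ 2 / τ := by positivity
  have t3 := dn (mle hq (le_refl |ex|))
  have t4 := up (mle hnst (mle hq hvx))
  have t5 := dn (mle hμa (mle hq hpx))
  have t6 := dn (mle hκa (mle hq hA))
  have t7 := up (mle hVst (mle hq hp))
  have t8 := up (mle hq hF)
  have t9 := up (mle (le_refl |qx|) hP)
  have t10 : 0 ≤ a * (2 / τ * e ^ 2) := by positivity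
  have t11 := up (mle haa (mle hτa (mle he hp)))
  have t12 := dn (mle haa (mle hμ5 (mle he (le_refl |qx|))))
  have t13 := up (mle haa (mle hVst (mle he hq)))
  have t14 := up (mle haa (mle he hG))
  have t15 := up (mle haa (mle hJst (mle he hvx)))
  have t16 := up (mle haa (mle (le_refl |ex|) hQ))
  have t17 := dn (mle haa (mle (le_refl |ex|) hR))
  have t18 : -(a * (κ * (ex * dS))) ≤ a * (c * (|ex| * (c * (s * X + |pxx|)))) :=
    dn (mle haa' (mle hκa (mle (le_refl |ex|) hS)))
  have t19 : a * (c * (|ex| * (c * (s * X + |pxx|))))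
      ≤ c ^ 2 * (s * X * |ex|) + a * c ^ 2 * (|ex| * |pxx|) := by
    have h : a * (c ^ 2 * (s * X * |ex|)) ≤ 1 * (c ^ 2 * (s * X * |ex|)) := by gcongr
    have e : a * (c * (|ex| * (c * (s * X + |pxx|))))
        = a * (c ^ 2 * (s * X * |ex|)) + a * c ^ 2 * (|ex| * |pxx|) := by ring
    linarith only [h, e]
  have hcc : c ≤ c ^ 2 := le_self_pow₀ hc two_ne_zero
  have h1c : 1 ≤ c ^ 2 := one_le_pow₀ hc
  have lift : ∀ Z : ℝ, 0 ≤ Z → X * Z ≤ c ^ 2 * (s * X * Z) ∧ c * (X * Z) ≤ c ^ 2 * (s * X * Z)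
      ∧ c ^ 2 * (X * Z) ≤ c ^ 2 * (s * X * Z) := by
    intro Z hZ
    have hXZ : 0 ≤ X * Z := by positivity
    have h3 : X * Z ≤ s * X * Z := by
      have := mul_le_mul_of_nonneg_right hs hXZ
      linarith only [this]
    have h4 : c ^ 2 * (X * Z) ≤ c ^ 2 * (s * X * Z) := by gcongr
    have h5 := mul_le_mul_of_nonneg_right hcc hXZ
    have h6 := mul_le_mul_of_nonneg_right h1c hXZ
    exact ⟨by linarith only [h4, h6], by linarith only [h4, h5], h4⟩
  obtain ⟨q1, q2, q3⟩ := lift _ hQx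
  obtain ⟨e1, e2, e3⟩ := lift _ hEx
  obtain ⟨p1, p2, p3⟩ := lift _ hPx
  obtain ⟨x1, x2, x3⟩ := lift _ hX
  have hexpx : 0 ≤ a * c ^ 2 * (|ex| * |pxx|) := by positivity
  have hsq : 0 ≤ ν * px ^ 2 := by positivity
  rw [sq_abs, sq_abs, sq_abs]
  have hsX : ∀ Z : ℝ, 0 ≤ Z → 0 ≤ c ^ 2 * (s * X * Z) := fun Z hZ => by positivity
  have z1 := hsX _ hQx
  have z2 := hsX _ hEx
  have z3 := hsX _ hPx
  have z4 := hsX _ hX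
  linarith only [t1, t2, t3, t4, t5, t6, t7, t8, t9, t10, t11, t12, t13, t14, t15, t16, t17, t18,
    t19, q1, q2, q3, e1, e2, e3, p1, p2, p3, x1, x2, x3, hexpx, hsq, z1, z2, z3, z4]

/-- The convective momentum flux of the perturbation system. -/
def fluxP (ns Js n J : ℝ → ℝ) : ℝ → ℝ := fun y =>
  (Js y + J y) ^ 2 / (ns y + n y) - (Js y) ^ 2 / ns y

/-- The convective energy flux of the perturbation system. -/
def fluxQ (ns Js Es n J E : ℝ → ℝ) : ℝ → ℝ := fun y =>
  (Js y + J y) / (ns y + n y) * (Es y + E y) - Js y / ns y * Es y - (3/2) * J y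

/-- The cubic energy flux of the perturbation system. -/
def fluxR (ns Js n J : ℝ → ℝ) : ℝ → ℝ := fun y =>
  (Js y + J y) ^ 3 / (ns y + n y) ^ 2 - (Js y) ^ 3 / (ns y) ^ 2

/-- The quantum energy flux of the perturbation system. -/
def fluxS (ns Js n J : ℝ → ℝ) : ℝ → ℝ := fun y =>
  (Js y + J y) * iteratedDeriv 2 (fun z => ns z + n z) y / (ns y + n y)
    - Js y * iteratedDeriv 2 ns y / ns y
    - (Js y + J y) * (deriv (fun z => ns z + n z) y) ^ 2 / (ns y + n y) ^ 2
    + Js y * (deriv ns y) ^ 2 / (ns y) ^ 2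

/-- The quantum momentum source of the perturbation system. -/
def sourceA (ns n : ℝ → ℝ) : ℝ → ℝ := fun x =>
  2 * deriv (fun y => ns y + n y) x * iteratedDeriv 2 (fun y => ns y + n y) x / (ns x + n x)
    - 2 * deriv ns x * iteratedDeriv 2 ns x / ns x
    - (deriv (fun y => ns y + n y) x) ^ 3 / (ns x + n x)
    + (deriv ns x) ^ 3 / ns x

theorem g1fun_eq (ε : ℝ) (ns Js Vs n J V : ℝ → ℝ) (x : ℝ) :
    g1fun ε ns Js Vs n J V x = -(ε ^ 2 / 18) * sourceA ns n x
      - (2/3) * deriv (fluxP ns Js n J) x + deriv Vs x * n x + n x * deriv V x := rfl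

theorem g2fun_eq (ε : ℝ) (ns Js Es Vs n J E V : ℝ → ℝ) (x : ℝ) :
    g2fun ε ns Js Es Vs n J E V x = -(5/3) * deriv (fluxQ ns Js Es n J E) x
      + (1/3) * deriv (fluxR ns Js n J) x
      + deriv Vs x * J x + J x * deriv V x + Js x * deriv V x
      + (ε ^ 2 / 18) * deriv (fluxS ns Js n J) x := rfl

/-- The set where both the steady and the perturbed density are positive. -/
def posSet (ns n : ℝ → ℝ) : Set ℝ := {x | 0 < ns x ∧ 0 < ns x + n x}

theorem isOpen_posSet {ns n : ℝ → ℝ} (hns : Continuous ns) (hn : Continuous n) :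
    IsOpen (posSet ns n) :=
  (isOpen_lt continuous_const hns).inter (isOpen_lt continuous_const (hns.add hn))

theorem ContDiff.deriv_of_le {m k : ℕ} (hmk : m + 1 ≤ k) {f : ℝ → ℝ} (hf : ContDiff ℝ k f) :
    ContDiff ℝ m (deriv f) := by
  have := hf.of_le (m := ((m + 1 : ℕ) : WithTop ℕ∞)) (by exact_mod_cast hmk)
  rw [Nat.cast_add, Nat.cast_one, contDiff_succ_iff_deriv] at this
  exact this.2.2

theorem ContDiff.iteratedDeriv_two_of_le {m k : ℕ} (hmk : m + 2 ≤ k) {f : ℝ → ℝ}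
    (hf : ContDiff ℝ k f) : ContDiff ℝ m (iteratedDeriv 2 f) := by
  rw [iteratedDeriv_succ, iteratedDeriv_one]
  exact (hf.deriv_of_le (m := m + 1) (by omega)).deriv_of_le le_rfl

section flux

variable {ns Js Es n J E : ℝ → ℝ}

theorem contDiffOn_fluxP (hns : ContDiff ℝ 4 ns) (hJs : ContDiff ℝ 3 Js) (hn : ContDiff ℝ 4 n)
    (hJ : ContDiff ℝ 3 J) : ContDiffOn ℝ 2 (fluxP ns Js n J) (posSet ns n) := by
  have hns := (hns.of_le (m := 2) (by norm_num)).contDiffOn (s := posSet ns n)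
  have hn := (hn.of_le (m := 2) (by norm_num)).contDiffOn (s := posSet ns n)
  have hJs := (hJs.of_le (m := 2) (by norm_num)).contDiffOn (s := posSet ns n)
  have hJ := (hJ.of_le (m := 2) (by norm_num)).contDiffOn (s := posSet ns n)
  exact (((hJs.add hJ).pow 2).div (hns.add hn) fun x hx => hx.2.ne').sub
    ((hJs.pow 2).div hns fun x hx => hx.1.ne')

theorem contDiffOn_fluxQ (hns : ContDiff ℝ 4 ns) (hJs : ContDiff ℝ 3 Js) (hEs : ContDiff ℝ 3 Es)
    (hn : ContDiff ℝ 4 n) (hJ : ContDiff ℝ 3 J) (hE : ContDiff ℝ 3 E) :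
    ContDiffOn ℝ 2 (fluxQ ns Js Es n J E) (posSet ns n) := by
  have hns := (hns.of_le (m := 2) (by norm_num)).contDiffOn (s := posSet ns n)
  have hn := (hn.of_le (m := 2) (by norm_num)).contDiffOn (s := posSet ns n)
  have hJs := (hJs.of_le (m := 2) (by norm_num)).contDiffOn (s := posSet ns n)
  have hJ := (hJ.of_le (m := 2) (by norm_num)).contDiffOn (s := posSet ns n)
  have hEs := (hEs.of_le (m := 2) (by norm_num)).contDiffOn (s := posSet ns n)
  have hE := (hE.of_le (m := 2) (by norm_num)).contDiffOn (s := posSet ns n)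
  exact ((((hJs.add hJ).div (hns.add hn) fun x hx => hx.2.ne').mul (hEs.add hE)).sub
    ((hJs.div hns fun x hx => hx.1.ne').mul hEs)).sub (contDiffOn_const.mul hJ)

theorem contDiffOn_fluxR (hns : ContDiff ℝ 4 ns) (hJs : ContDiff ℝ 3 Js) (hn : ContDiff ℝ 4 n)
    (hJ : ContDiff ℝ 3 J) : ContDiffOn ℝ 2 (fluxR ns Js n J) (posSet ns n) := by
  have hns := (hns.of_le (m := 2) (by norm_num)).contDiffOn (s := posSet ns n)
  have hn := (hn.of_le (m := 2) (by norm_num)).contDiffOn (s := posSet ns n)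
  have hJs := (hJs.of_le (m := 2) (by norm_num)).contDiffOn (s := posSet ns n)
  have hJ := (hJ.of_le (m := 2) (by norm_num)).contDiffOn (s := posSet ns n)
  exact (((hJs.add hJ).pow 3).div ((hns.add hn).pow 2) fun x hx => (pow_pos hx.2 2).ne').sub
    ((hJs.pow 3).div (hns.pow 2) fun x hx => (pow_pos hx.1 2).ne')

theorem contDiffOn_fluxS (hns : ContDiff ℝ 4 ns) (hJs : ContDiff ℝ 3 Js) (hn : ContDiff ℝ 4 n)
    (hJ : ContDiff ℝ 3 J) : ContDiffOn ℝ 2 (fluxS ns Js n J) (posSet ns n) := by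
  have hN : ContDiff ℝ 4 (fun z => ns z + n z) := hns.add hn
  have hN2 := (ContDiff.iteratedDeriv_two_of_le (m := 2) (k := 4) le_rfl hN).contDiffOn
    (s := posSet ns n)
  have hN1 := (ContDiff.deriv_of_le (m := 2) (k := 4) (by norm_num) hN).contDiffOn
    (s := posSet ns n)
  have hns2 := (ContDiff.iteratedDeriv_two_of_le (m := 2) (k := 4) le_rfl hns).contDiffOn
    (s := posSet ns n)
  have hns1 := (ContDiff.deriv_of_le (m := 2) (k := 4) (by norm_num) hns).contDiffOn
    (s := posSet ns n)
  have hns := (hns.of_le (m := 2) (by norm_num)).contDiffOn (s := posSet ns n)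
  have hN := (hN.of_le (m := 2) (by norm_num)).contDiffOn (s := posSet ns n)
  have hJs := (hJs.of_le (m := 2) (by norm_num)).contDiffOn (s := posSet ns n)
  have hJ := (hJ.of_le (m := 2) (by norm_num)).contDiffOn (s := posSet ns n)
  exact (((((hJs.add hJ).mul hN2).div hN fun x hx => hx.2.ne').sub
    ((hJs.mul hns2).div hns fun x hx => hx.1.ne')).sub
    (((hJs.add hJ).mul (hN1.pow 2)).div (hN.pow 2) fun x hx => (pow_pos hx.2 2).ne')).add
    ((hJs.mul (hns1.pow 2)).div (hns.pow 2) fun x hx => (pow_pos hx.1 2).ne')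

theorem contDiffOn_sourceA (hns : ContDiff ℝ 4 ns) (hn : ContDiff ℝ 4 n) :
    ContDiffOn ℝ 1 (sourceA ns n) (posSet ns n) := by
  have hN : ContDiff ℝ 4 (fun z => ns z + n z) := hns.add hn
  have hN2 := (ContDiff.iteratedDeriv_two_of_le (m := 1) (k := 4) (by norm_num) hN).contDiffOn
    (s := posSet ns n)
  have hN1 := (ContDiff.deriv_of_le (m := 1) (k := 4) (by norm_num) hN).contDiffOn
    (s := posSet ns n)
  have hns2 := (ContDiff.iteratedDeriv_two_of_le (m := 1) (k := 4) (by norm_num) hns).contDiffOn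
    (s := posSet ns n)
  have hns1 := (ContDiff.deriv_of_le (m := 1) (k := 4) (by norm_num) hns).contDiffOn
    (s := posSet ns n)
  have hns := (hns.of_le (m := 1) (by norm_num)).contDiffOn (s := posSet ns n)
  have hN := (hN.of_le (m := 1) (by norm_num)).contDiffOn (s := posSet ns n)
  exact (((((contDiffOn_const.mul hN1).mul hN2).div hN fun x hx => hx.2.ne').sub
    (((contDiffOn_const.mul hns1).mul hns2).div hns fun x hx => hx.1.ne')).sub
    ((hN1.pow 3).div hN fun x hx => hx.2.ne')).add
    ((hns1.pow 3).div hns fun x hx => hx.1.ne')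

end flux

section solution

variable {ν ε τ lam μ T Jb Vb : ℝ} {ρ ns Js Es Vs : ℝ → ℝ} {tn tJ tE tV : ℝ → ℝ → ℝ}

theorem IsPerturbSol.subset_posSet
    (hs : IsSteadySol ν ε τ lam μ Jb Vb ρ ns Js Es Vs)
    (h : IsPerturbSol ν ε τ lam μ T ns Js Es Vs tn tJ tE tV) {t : ℝ} (ht : t ∈ Icc (0:ℝ) T) :
    Icc (0:ℝ) 1 ⊆ posSet ns (tn t) :=
  fun x hx => ⟨hs.npos x hx, h.npos t ht x hx⟩

theorem IsPerturbSol.isOpen_posSet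
    (hs : IsSteadySol ν ε τ lam μ Jb Vb ρ ns Js Es Vs)
    (h : IsPerturbSol ν ε τ lam μ T ns Js Es Vs tn tJ tE tV) {t : ℝ} (ht : t ∈ Icc (0:ℝ) T) :
    IsOpen (posSet ns (tn t)) :=
  _root_.isOpen_posSet hs.smooth_n.continuous (h.reg_n t ht).continuous

theorem IsPerturbSol.contDiffOn_tderiv
    (hs : IsSteadySol ν ε τ lam μ Jb Vb ρ ns Js Es Vs)
    (h : IsPerturbSol ν ε τ lam μ T ns Js Es Vs tn tJ tE tV) {t : ℝ} (ht : t ∈ Icc (0:ℝ) T) :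
    ContDiffOn ℝ 2 (tderiv tn t) (Icc 0 1) ∧ ContDiffOn ℝ 1 (tderiv tJ t) (Icc 0 1) ∧
      ContDiffOn ℝ 1 (tderiv tE t) (Icc 0 1) := by
  have hn := h.reg_n t ht
  have hJ := h.reg_J t ht
  have hE := h.reg_E t ht
  have hV := h.reg_V t ht
  have hU := h.subset_posSet hs ht
  have hO := h.isOpen_posSet hs ht
  have low : ∀ {k : ℕ} {f : ℝ → ℝ}, 1 ≤ k → ContDiff ℝ k f → ContDiffOn ℝ 1 f (Icc 0 1) :=
    fun hk hf => (hf.of_le (by exact_mod_cast hk)).contDiffOn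
  have ldv : ∀ {k : ℕ} {f : ℝ → ℝ}, 2 ≤ k → ContDiff ℝ k f → ContDiffOn ℝ 1 (deriv f) (Icc 0 1) :=
    fun hk hf => (hf.deriv_of_le (m := 1) hk).contDiffOn
  have dfl : ∀ {f : ℝ → ℝ}, ContDiffOn ℝ 2 f (posSet ns (tn t)) →
      ContDiffOn ℝ 1 (deriv f) (Icc 0 1) :=
    fun hf => (hf.deriv_of_isOpen hO (by norm_num)).mono hU
  have cP := dfl (contDiffOn_fluxP hs.smooth_n hs.smooth_J hn hJ)
  have cQ := dfl (contDiffOn_fluxQ hs.smooth_n hs.smooth_J hs.smooth_E hn hJ hE)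
  have cR := dfl (contDiffOn_fluxR hs.smooth_n hs.smooth_J hn hJ)
  have cS := dfl (contDiffOn_fluxS hs.smooth_n hs.smooth_J hn hJ)
  have cA := (contDiffOn_sourceA hs.smooth_n hn).mono hU
  have n0 := low (k := 4) (by norm_num) hn
  have J0 := low (k := 3) (by norm_num) hJ
  have E0 := low (k := 3) (by norm_num) hE
  have Js0 := low (k := 3) (by norm_num) hs.smooth_J
  have ns0 := low (k := 4) (by norm_num) hs.smooth_n
  have V1 := ldv (k := 6) (by norm_num) hV
  have Vs1 := ldv (k := 6) (by norm_num) hs.smooth_V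
  have n1 := ldv (k := 4) (by norm_num) hn
  have J1 := ldv (k := 3) (by norm_num) hJ
  have E1 := ldv (k := 3) (by norm_num) hE
  have J2 := (ContDiff.iteratedDeriv_two_of_le (m := 1) (k := 3) le_rfl hJ).contDiffOn
    (s := Icc (0:ℝ) 1)
  have E2 := (ContDiff.iteratedDeriv_two_of_le (m := 1) (k := 3) le_rfl hE).contDiffOn
    (s := Icc (0:ℝ) 1)
  have n3 : ContDiffOn ℝ 1 (iteratedDeriv 3 (tn t)) (Icc (0:ℝ) 1) := by
    rw [iteratedDeriv_succ]
    exact ldv (k := 2) le_rfl (ContDiff.iteratedDeriv_two_of_le (m := 2) (k := 4) le_rfl hn)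
  refine ⟨?_, ?_, ?_⟩
  · have n2 := (ContDiff.iteratedDeriv_two_of_le (m := 2) (k := 4) le_rfl hn).contDiffOn
      (s := Icc (0:ℝ) 1)
    have J1 := (hJ.deriv_of_le (m := 2) (k := 3) le_rfl).contDiffOn (s := Icc (0:ℝ) 1)
    refine (((contDiffOn_const (c := ν)).mul n2).sub J1).congr fun x hx => ?_
    have := h.eq1 t ht x hx
    linarith
  · refine ((((((contDiffOn_const (c := ν)).mul J2).sub (J0.div_const τ)).add
      ((contDiffOn_const (c := ε ^ 2 / 18)).mul n3)).sub ((contDiffOn_const (c := 2/3)).mul E1)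
      |>.add (ns0.mul V1) |>.sub ((contDiffOn_const (c := μ)).mul n1)).add
      ((((contDiffOn_const (c := -(ε ^ 2 / 18))).mul cA).sub
      ((contDiffOn_const (c := 2/3)).mul cP)).add (Vs1.mul n0) |>.add (n0.mul V1))).congr
      fun x hx => ?_
    have := h.eq2 t ht x hx
    rw [g1fun_eq] at this
    linarith
  · refine (((((contDiffOn_const (c := ν)).mul E2).sub ((contDiffOn_const (c := 2/τ)).mul E0)).add
      ((contDiffOn_const (c := 3/τ)).mul n0)).sub ((contDiffOn_const (c := μ + 5/2)).mul J1)
      |>.add (((((contDiffOn_const (c := -(5/3))).mul cQ).add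
      ((contDiffOn_const (c := 1/3)).mul cR)).add (Vs1.mul J0) |>.add (J0.mul V1)
      |>.add (Js0.mul V1)).add ((contDiffOn_const (c := ε ^ 2 / 18)).mul cS))).congr
      fun x hx => ?_
    have := h.eq3 t ht x hx
    rw [g2fun_eq] at this
    linarith

end solution

/-- `k` dominates the time derivatives, uniformly in space, and the square of the second space
derivative of the density. -/
structure HasRate (T : ℝ) (tn tJ tE : ℝ → ℝ → ℝ) (k : ℝ → ℝ) : Prop where
  n : ∀ t ∈ Icc (0:ℝ) T, ∀ x ∈ Icc (0:ℝ) 1, |tderiv tn t x| ≤ k t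
  J : ∀ t ∈ Icc (0:ℝ) T, ∀ x ∈ Icc (0:ℝ) 1, |tderiv tJ t x| ≤ k t
  E : ∀ t ∈ Icc (0:ℝ) T, ∀ x ∈ Icc (0:ℝ) 1, |tderiv tE t x| ≤ k t
  lip : ∀ t ∈ Icc (0:ℝ) T, ∀ x ∈ Icc (0:ℝ) 1, ∀ y ∈ Icc (0:ℝ) 1,
    |tderiv tn t x - tderiv tn t y| ≤ k t * |x - y|
  nxx : ∀ t ∈ Icc (0:ℝ) T, ∀ x ∈ Icc (0:ℝ) 1, iteratedDeriv 2 (tn t) x ^ 2 ≤ k t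

theorem HasRate.mono {T : ℝ} {tn tJ tE : ℝ → ℝ → ℝ} {k l : ℝ → ℝ} (h : HasRate T tn tJ tE k)
    (hkl : ∀ t, k t ≤ l t) : HasRate T tn tJ tE l where
  n t ht x hx := (h.n t ht x hx).trans (hkl t)
  J t ht x hx := (h.J t ht x hx).trans (hkl t)
  E t ht x hx := (h.E t ht x hx).trans (hkl t)
  lip t ht x hx y hy := (h.lip t ht x hx y hy).trans (by gcongr; exact hkl t)
  nxx t ht x hx := (h.nxx t ht x hx).trans (hkl t)

/-- A function whose oscillation in time is controlled by a continuous function, uniformly in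
space, is bounded. -/
theorem continuousOn_uncurry_of_abs_sub_le {u : ℝ → ℝ → ℝ} {G : ℝ → ℝ} {T : ℝ}
    (hG : ContinuousOn G (Icc 0 T)) (hu : ∀ t ∈ Icc (0:ℝ) T, ContinuousOn (u t) (Icc 0 1))
    (h : ∀ s ∈ Icc (0:ℝ) T, ∀ t ∈ Icc (0:ℝ) T, ∀ x ∈ Icc (0:ℝ) 1,
      |u t x - u s x| ≤ |G t - G s|) :
    ContinuousOn (fun p : ℝ × ℝ => u p.1 p.2) (Icc 0 T ×ˢ Icc 0 1) := by
  rintro ⟨s, y⟩ ⟨hs, hy⟩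
  have h1 : Tendsto (fun p : ℝ × ℝ => |G p.1 - G s| + |u s p.2 - u s y|)
      (𝓝[Icc 0 T ×ˢ Icc 0 1] (s, y)) (𝓝 0) := by
    have a1 : ContinuousWithinAt (fun p : ℝ × ℝ => |G p.1 - G s| + |u s p.2 - u s y|)
        (Icc 0 T ×ˢ Icc 0 1) (s, y) := by
      have b1 : ContinuousWithinAt (fun p : ℝ × ℝ => G p.1) (Icc 0 T ×ˢ Icc 0 1) (s, y) :=
        ContinuousWithinAt.comp (t := Icc 0 T) (hG s hs) continuousWithinAt_fst fun p hp => hp.1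
      have b2 : ContinuousWithinAt (fun p : ℝ × ℝ => u s p.2) (Icc 0 T ×ˢ Icc 0 1) (s, y) :=
        ContinuousWithinAt.comp (t := Icc 0 1) (hu s hs y hy) continuousWithinAt_snd
          fun p hp => hp.2
      exact (b1.sub continuousWithinAt_const).abs.add (b2.sub continuousWithinAt_const).abs
    have := a1.tendsto
    simpa using this
  refine tendsto_iff_dist_tendsto_zero.2 (squeeze_zero' (Eventually.of_forall fun _ => dist_nonneg)
    ?_ h1)
  filter_upwards [self_mem_nhdsWithin] with p hp
  rw [Real.dist_eq]
  have := abs_sub_le (u p.1 p.2) (u s p.2) (u s y)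
  exact this.trans (add_le_add_left (h s hs p.1 hp.1 p.2 hp.2) _)

section solution

variable {ν ε τ lam μ T Jb Vb : ℝ} {ρ ns Js Es Vs : ℝ → ℝ} {tn tJ tE tV : ℝ → ℝ → ℝ}

theorem IsPerturbSol.exists_hasRate
    (hs : IsSteadySol ν ε τ lam μ Jb Vb ρ ns Js Es Vs)
    (h : IsPerturbSol ν ε τ lam μ T ns Js Es Vs tn tJ tE tV)
    (hn : MemH1H 2 T tn) (hn4 : MemL2H 4 T tn) (hJ : MemH1H 1 T tJ) (hE : MemH1H 1 T tE) :
    ∃ k : ℝ → ℝ, IntervalIntegrable k volume 0 T ∧ (∀ t, 1 ≤ k t) ∧ HasRate T tn tJ tE k := by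
  refine ⟨fun t => 1 + 2 * sobSq 2 (tderiv tn t) + 2 * sobSq 1 (tderiv tJ t)
    + 2 * sobSq 1 (tderiv tE t) + 2 * sobSq 4 (tn t), ?_, ?_, ?_⟩
  · exact ((((intervalIntegrable_const).add (hn.2.const_mul 2)).add (hJ.2.const_mul 2)).add
      (hE.2.const_mul 2)).add (hn4.const_mul 2)
  · intro t
    have := sobSq_nonneg 2 (tderiv tn t)
    have := sobSq_nonneg 1 (tderiv tJ t)
    have := sobSq_nonneg 1 (tderiv tE t)
    have := sobSq_nonneg 4 (tn t)
    dsimp only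
    linarith
  · have h1 := fun t => sobSq_nonneg 2 (tderiv tn t)
    have h2 := fun t => sobSq_nonneg 1 (tderiv tJ t)
    have h3 := fun t => sobSq_nonneg 1 (tderiv tE t)
    have h4 := fun t => sobSq_nonneg 4 (tn t)
    refine ⟨fun t ht x hx => ?_, fun t ht x hx => ?_, fun t ht x hx => ?_,
      fun t ht x hx y hy => ?_, fun t ht x hx => ?_⟩
    · have c := (h.contDiffOn_tderiv hs ht).1
      have := abs_le_one_add_of_sq_le
        (sq_le_sobSq_of_contDiffOn (k := 2) (by norm_num) (c.of_le (by norm_num)) hx)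
      linarith [h2 t, h3 t, h4 t]
    · have c := (h.contDiffOn_tderiv hs ht).2.1
      have := abs_le_one_add_of_sq_le (sq_le_sobSq_of_contDiffOn le_rfl c hx)
      linarith [h1 t, h3 t, h4 t]
    · have c := (h.contDiffOn_tderiv hs ht).2.2
      have := abs_le_one_add_of_sq_le (sq_le_sobSq_of_contDiffOn le_rfl c hx)
      linarith [h1 t, h2 t, h4 t]
    · have c := (h.contDiffOn_tderiv hs ht).1
      refine (abs_sub_le_sobSq_of_contDiffOn c hx hy).trans
        (mul_le_mul_of_nonneg_right ?_ (abs_nonneg _))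
      linarith [h2 t, h3 t, h4 t]
    · have := sq_iteratedDeriv_le_sobSq (k := 4) (i := 2) (h.reg_n t ht) (by norm_num) hx
      linarith [h1 t, h2 t, h3 t]

theorem IsPerturbSol.abs_sub_le
    (h : IsPerturbSol ν ε τ lam μ T ns Js Es Vs tn tJ tE tV) {k : ℝ → ℝ}
    (hk : IntervalIntegrable k volume 0 T) (hr : HasRate T tn tJ tE k) {s t : ℝ}
    (hs : s ∈ Icc (0:ℝ) T) (ht : t ∈ Icc (0:ℝ) T) {x : ℝ} (hx : x ∈ Icc (0:ℝ) 1) :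
    |tn t x - tn s x| ≤ |(∫ r in (0:ℝ)..t, k r) - ∫ r in (0:ℝ)..s, k r| ∧
    |tJ t x - tJ s x| ≤ |(∫ r in (0:ℝ)..t, k r) - ∫ r in (0:ℝ)..s, k r| ∧
    |tE t x - tE s x| ≤ |(∫ r in (0:ℝ)..t, k r) - ∫ r in (0:ℝ)..s, k r| ∧
    |deriv (tn t) x - deriv (tn s) x| ≤ |(∫ r in (0:ℝ)..t, k r) - ∫ r in (0:ℝ)..s, k r| :=
  ⟨abs_sub_le_abs_primitive_sub (f := fun s => tn s x) hk (fun t ht => (h.reg_t t ht x hx).1)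
      (fun t ht => hr.n t ht x hx) hs ht,
    abs_sub_le_abs_primitive_sub (f := fun s => tJ s x) hk (fun t ht => (h.reg_t t ht x hx).2.1)
      (fun t ht => hr.J t ht x hx) hs ht,
    abs_sub_le_abs_primitive_sub (f := fun s => tE s x) hk (fun t ht => (h.reg_t t ht x hx).2.2.1)
      (fun t ht => hr.E t ht x hx) hs ht,
    abs_deriv_sub_le_abs_primitive_sub hk (fun t ht x hx => (h.reg_t t ht x hx).1) hr.lip
      (fun t ht => (h.reg_n t ht).of_le (by norm_num)) hs ht hx⟩

theorem continuousOn_primitive_Icc {k : ℝ → ℝ} (hT : 0 ≤ T)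
    (hk : IntervalIntegrable k volume 0 T) :
    ContinuousOn (fun t => ∫ r in (0:ℝ)..t, k r) (Icc 0 T) := by
  rw [← uIcc_of_le hT]
  exact intervalIntegral.continuousOn_primitive_interval' hk left_mem_uIcc

theorem IsPerturbSol.abs_deriv_potential_le (hlam : 0 < lam)
    (h : IsPerturbSol ν ε τ lam μ T ns Js Es Vs tn tJ tE tV) {t B : ℝ} (ht : t ∈ Icc (0:ℝ) T)
    (hB : ∀ x ∈ Icc (0:ℝ) 1, |tn t x| ≤ B) {x : ℝ} (hx : x ∈ Icc (0:ℝ) 1) :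
    |deriv (tV t) x| ≤ B / lam ^ 2 := by
  have hd : ∀ y ∈ Icc (0:ℝ) 1, HasDerivWithinAt (deriv (tV t)) (iteratedDeriv 2 (tV t) y)
      (Icc 0 1) y := by
    intro y _
    rw [iteratedDeriv_succ, iteratedDeriv_one]
    exact ((ContDiff.deriv_of_le (m := 5) (k := 6) le_rfl (h.reg_V t ht)).differentiable
      (by norm_num) y).hasDerivAt.hasDerivWithinAt
  have hb : ∀ y ∈ Icc (0:ℝ) 1, ‖iteratedDeriv 2 (tV t) y‖ ≤ B / lam ^ 2 := by
    intro y hy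
    have := h.eq4 t ht y hy
    have e : iteratedDeriv 2 (tV t) y = tn t y / lam ^ 2 := by
      field_simp; linarith
    rw [e, Real.norm_eq_abs, abs_div, abs_of_pos (by positivity : 0 < lam ^ 2)]
    gcongr
    exact hB y hy
  have := Convex.norm_image_sub_le_of_norm_hasDerivWithin_le hd hb (convex_Icc 0 1)
    (left_mem_Icc.2 zero_le_one) hx
  rw [(h.bc_V t ht).2.2.1, sub_zero, sub_zero, Real.norm_eq_abs, Real.norm_eq_abs,
    abs_of_nonneg hx.1] at this
  refine this.trans (mul_le_of_le_one_right ?_ hx.2)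
  exact (norm_nonneg _).trans (hb x hx)

/-- A uniform bound for the lower order part of a solution. -/
structure LowBound (T M : ℝ) (ns : ℝ → ℝ) (tn tJ tE tV : ℝ → ℝ → ℝ) : Prop where
  n : ∀ t ∈ Icc (0:ℝ) T, ∀ x ∈ Icc (0:ℝ) 1, |tn t x| ≤ M
  J : ∀ t ∈ Icc (0:ℝ) T, ∀ x ∈ Icc (0:ℝ) 1, |tJ t x| ≤ M
  E : ∀ t ∈ Icc (0:ℝ) T, ∀ x ∈ Icc (0:ℝ) 1, |tE t x| ≤ M
  nx : ∀ t ∈ Icc (0:ℝ) T, ∀ x ∈ Icc (0:ℝ) 1, |deriv (tn t) x| ≤ M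
  Vx : ∀ t ∈ Icc (0:ℝ) T, ∀ x ∈ Icc (0:ℝ) 1, |deriv (tV t) x| ≤ M
  inv : ∀ t ∈ Icc (0:ℝ) T, ∀ x ∈ Icc (0:ℝ) 1, (ns x + tn t x)⁻¹ ≤ M

theorem LowBound.mono {M M' : ℝ} (h : LowBound T M ns tn tJ tE tV) (hM : M ≤ M') :
    LowBound T M' ns tn tJ tE tV where
  n t ht x hx := (h.n t ht x hx).trans hM
  J t ht x hx := (h.J t ht x hx).trans hM
  E t ht x hx := (h.E t ht x hx).trans hM
  nx t ht x hx := (h.nx t ht x hx).trans hM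
  Vx t ht x hx := (h.Vx t ht x hx).trans hM
  inv t ht x hx := (h.inv t ht x hx).trans hM

theorem IsPerturbSol.exists_lowBound (hT : 0 ≤ T) (hlam : 0 < lam)
    (hs : IsSteadySol ν ε τ lam μ Jb Vb ρ ns Js Es Vs)
    (h : IsPerturbSol ν ε τ lam μ T ns Js Es Vs tn tJ tE tV) {k : ℝ → ℝ}
    (hk : IntervalIntegrable k volume 0 T) (hr : HasRate T tn tJ tE k) :
    ∃ M, LowBound T M ns tn tJ tE tV := by
  have hG := continuousOn_primitive_Icc hT hk
  have hK : IsCompact (Icc (0:ℝ) T ×ˢ Icc (0:ℝ) 1) := isCompact_Icc.prod isCompact_Icc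
  have cn := continuousOn_uncurry_of_abs_sub_le hG
    (fun t ht => (h.reg_n t ht).continuous.continuousOn)
    (fun s hs t ht x hx => (h.abs_sub_le hk hr hs ht hx).1)
  have cJ := continuousOn_uncurry_of_abs_sub_le hG
    (fun t ht => (h.reg_J t ht).continuous.continuousOn)
    (fun s hs t ht x hx => (h.abs_sub_le hk hr hs ht hx).2.1)
  have cE := continuousOn_uncurry_of_abs_sub_le hG
    (fun t ht => (h.reg_E t ht).continuous.continuousOn)
    (fun s hs t ht x hx => (h.abs_sub_le hk hr hs ht hx).2.2.1)
  have cd := continuousOn_uncurry_of_abs_sub_le (u := fun t => deriv (tn t)) hG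
    (fun t ht => ((h.reg_n t ht).continuous_deriv (by norm_num)).continuousOn)
    (fun s hs t ht x hx => (h.abs_sub_le hk hr hs ht hx).2.2.2)
  have ci : ContinuousOn (fun p : ℝ × ℝ => (ns p.2 + tn p.1 p.2)⁻¹)
      (Icc (0:ℝ) T ×ˢ Icc (0:ℝ) 1) := by
    refine ContinuousOn.inv₀ (((hs.smooth_n.continuous.comp continuous_snd).continuousOn).add cn)
      ?_
    rintro ⟨t, x⟩ ⟨ht, hx⟩
    exact (h.npos t ht x hx).ne'
  obtain ⟨A, hA⟩ := hK.exists_bound_of_continuousOn cn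
  obtain ⟨B, hB⟩ := hK.exists_bound_of_continuousOn cJ
  obtain ⟨C, hC⟩ := hK.exists_bound_of_continuousOn cE
  obtain ⟨D, hD⟩ := hK.exists_bound_of_continuousOn cd
  obtain ⟨I, hI⟩ := hK.exists_bound_of_continuousOn ci
  have h1 : A / lam ^ 2 ≤ |A / lam ^ 2| := le_abs_self _
  have hh : ∀ z : ℝ, z ≤ |z| ∧ 0 ≤ |z| := fun z => ⟨le_abs_self z, abs_nonneg z⟩
  obtain ⟨a1, a2⟩ := hh A
  obtain ⟨b1, b2⟩ := hh B
  obtain ⟨c1, c2⟩ := hh C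
  obtain ⟨d1, d2⟩ := hh D
  obtain ⟨i1, i2⟩ := hh I
  obtain ⟨v1, v2⟩ := hh (A / lam ^ 2)
  refine ⟨|A| + |B| + |C| + |D| + |I| + |A / lam ^ 2|, ?_, ?_, ?_, ?_, ?_, ?_⟩
  · intro t ht x hx; have := hA (t, x) ⟨ht, hx⟩; rw [Real.norm_eq_abs] at this; linarith
  · intro t ht x hx; have := hB (t, x) ⟨ht, hx⟩; rw [Real.norm_eq_abs] at this; linarith
  · intro t ht x hx; have := hC (t, x) ⟨ht, hx⟩; rw [Real.norm_eq_abs] at this; linarith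
  · intro t ht x hx; have := hD (t, x) ⟨ht, hx⟩; rw [Real.norm_eq_abs] at this; linarith
  · intro t ht x hx
    have := h.abs_deriv_potential_le hlam ht (fun y hy => hA (t, y) ⟨ht, hy⟩) hx
    linarith
  · intro t ht x hx
    have := (le_abs_self _).trans (hI (t, x) ⟨ht, hx⟩)
    dsimp only at this
    linarith

end solution

/-- A bound for the steady state and its derivatives. -/
structure SteadyBound (M : ℝ) (ns Js Es Vs : ℝ → ℝ) : Prop where
  n : ∀ x ∈ Icc (0:ℝ) 1, |ns x| ≤ M
  J : ∀ x ∈ Icc (0:ℝ) 1, |Js x| ≤ M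
  E : ∀ x ∈ Icc (0:ℝ) 1, |Es x| ≤ M
  nx : ∀ x ∈ Icc (0:ℝ) 1, |deriv ns x| ≤ M
  nxx : ∀ x ∈ Icc (0:ℝ) 1, |iteratedDeriv 2 ns x| ≤ M
  Vx : ∀ x ∈ Icc (0:ℝ) 1, |deriv Vs x| ≤ M

theorem SteadyBound.mono {M M' : ℝ} {ns Js Es Vs : ℝ → ℝ} (h : SteadyBound M ns Js Es Vs)
    (hM : M ≤ M') : SteadyBound M' ns Js Es Vs where
  n x hx := (h.n x hx).trans hM
  J x hx := (h.J x hx).trans hM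
  E x hx := (h.E x hx).trans hM
  nx x hx := (h.nx x hx).trans hM
  nxx x hx := (h.nxx x hx).trans hM
  Vx x hx := (h.Vx x hx).trans hM

theorem IsSteadySol.exists_steadyBound {ν ε τ lam μ Jb Vb : ℝ} {ρ ns Js Es Vs : ℝ → ℝ}
    (hs : IsSteadySol ν ε τ lam μ Jb Vb ρ ns Js Es Vs) : ∃ M, SteadyBound M ns Js Es Vs := by
  have hb : ∀ {f : ℝ → ℝ}, Continuous f → ∃ C, 0 ≤ C ∧ ∀ x ∈ Icc (0:ℝ) 1, |f x| ≤ C := by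
    intro f hf
    obtain ⟨C, hC⟩ := isCompact_Icc.exists_bound_of_continuousOn (s := Icc (0:ℝ) 1) hf.continuousOn
    exact ⟨C, (norm_nonneg _).trans (hC 0 ⟨le_rfl, zero_le_one⟩), hC⟩
  obtain ⟨A, a0, hA⟩ := hb hs.smooth_n.continuous
  obtain ⟨B, b0, hB⟩ := hb hs.smooth_J.continuous
  obtain ⟨C, c0, hC⟩ := hb hs.smooth_E.continuous
  obtain ⟨D, d0, hD⟩ := hb (hs.smooth_n.continuous_deriv (by norm_num))
  obtain ⟨F, f0, hF⟩ := hb (hs.smooth_n.continuous_iteratedDeriv 2 (by norm_num))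
  obtain ⟨G, g0, hG⟩ := hb (hs.smooth_V.continuous_deriv (by norm_num))
  refine ⟨A + B + C + D + F + G, ?_, ?_, ?_, ?_, ?_, ?_⟩
  · intro x hx; linarith [hA x hx]
  · intro x hx; linarith [hB x hx]
  · intro x hx; linarith [hC x hx]
  · intro x hx; linarith [hD x hx]
  · intro x hx; linarith [hF x hx]
  · intro x hx; linarith [hG x hx]

theorem ContDiff.hasDerivAt_iteratedDeriv {k i : ℕ} (hi : i + 1 ≤ k) {f : ℝ → ℝ}
    (hf : ContDiff ℝ k f) (x : ℝ) :
    HasDerivAt (iteratedDeriv i f) (iteratedDeriv (i + 1) f x) x := by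
  rw [iteratedDeriv_succ]
  exact (hf.differentiable_iteratedDeriv i (by exact_mod_cast hi) x).hasDerivAt

theorem ContDiff.hasDerivAt_deriv_two {k : ℕ} (hk : 2 ≤ k) {f : ℝ → ℝ}
    (hf : ContDiff ℝ k f) (x : ℝ) : HasDerivAt (deriv f) (iteratedDeriv 2 f x) x := by
  have := hf.hasDerivAt_iteratedDeriv (i := 1) hk x
  rwa [iteratedDeriv_one] at this

theorem deriv_add_of_contDiff {f g : ℝ → ℝ} (hf : ContDiff ℝ 4 f) (hg : ContDiff ℝ 4 g) (x : ℝ) :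
    deriv (fun y => f y + g y) x = deriv f x + deriv g x ∧
    iteratedDeriv 2 (fun y => f y + g y) x = iteratedDeriv 2 f x + iteratedDeriv 2 g x := by
  have h1 : ∀ x, deriv (fun y => f y + g y) x = deriv f x + deriv g x := fun x =>
    deriv_fun_add (hf.differentiable (by norm_num) x) (hg.differentiable (by norm_num) x)
  refine ⟨h1 x, ?_⟩
  have e : deriv (fun y => f y + g y) = fun y => deriv f y + deriv g y := funext h1
  rw [iteratedDeriv_succ, iteratedDeriv_one, e]
  exact ((hf.hasDerivAt_deriv_two (k := 4) (by norm_num) x).add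
    (hg.hasDerivAt_deriv_two (k := 4) (by norm_num) x)).deriv

section solution

variable {ν ε τ lam μ T Jb Vb : ℝ} {ρ ns Js Es Vs : ℝ → ℝ}
  {tn1 tJ1 tE1 tV1 tn2 tJ2 tE2 tV2 : ℝ → ℝ → ℝ}

/-- Lipschitz bounds for the fluxes of two solutions at a fixed time. -/
theorem flux_sub_bounds
    (hs : IsSteadySol ν ε τ lam μ Jb Vb ρ ns Js Es Vs)
    (h1 : IsPerturbSol ν ε τ lam μ T ns Js Es Vs tn1 tJ1 tE1 tV1)
    (h2 : IsPerturbSol ν ε τ lam μ T ns Js Es Vs tn2 tJ2 tE2 tV2)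
    {M s X t x : ℝ} (hM : 1 ≤ M) (hsb : SteadyBound M ns Js Es Vs)
    (hb1 : LowBound T M ns tn1 tJ1 tE1 tV1) (hb2 : LowBound T M ns tn2 tJ2 tE2 tV2)
    (ht : t ∈ Icc (0:ℝ) T) (hx : x ∈ Icc (0:ℝ) 1) (hs1 : 1 ≤ s)
    (hxx1 : |iteratedDeriv 2 (tn1 t) x| ≤ s) (hxx2 : |iteratedDeriv 2 (tn2 t) x| ≤ s)
    (hp : |tn1 t x - tn2 t x| ≤ X) (hpx : |deriv (tn1 t) x - deriv (tn2 t) x| ≤ X)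
    (hq : |tJ1 t x - tJ2 t x| ≤ X) (he : |tE1 t x - tE2 t x| ≤ X)
    (hvx : |deriv (tV1 t) x - deriv (tV2 t) x| ≤ X) :
    |sourceA ns (tn1 t) x - sourceA ns (tn2 t) x| ≤ (20 * (2 * M) ^ 6) * ((s + M) * X +
      |iteratedDeriv 2 (tn1 t) x - iteratedDeriv 2 (tn2 t) x|) ∧
    |fluxP ns Js (tn1 t) (tJ1 t) x - fluxP ns Js (tn2 t) (tJ2 t) x| ≤ (20 * (2 * M) ^ 6) * X ∧
    |fluxQ ns Js Es (tn1 t) (tJ1 t) (tE1 t) x - fluxQ ns Js Es (tn2 t) (tJ2 t) (tE2 t) x|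
      ≤ (20 * (2 * M) ^ 6 + 2) * X ∧
    |fluxR ns Js (tn1 t) (tJ1 t) x - fluxR ns Js (tn2 t) (tJ2 t) x| ≤ (20 * (2 * M) ^ 6) * X ∧
    |fluxS ns Js (tn1 t) (tJ1 t) x - fluxS ns Js (tn2 t) (tJ2 t) x| ≤ (20 * (2 * M) ^ 6) *
      ((s + M) * X + |iteratedDeriv 2 (tn1 t) x - iteratedDeriv 2 (tn2 t) x|) ∧
    |tn1 t x * deriv (tV1 t) x - tn2 t x * deriv (tV2 t) x| ≤ (2 * M) * X ∧
    |tJ1 t x * deriv (tV1 t) x - tJ2 t x * deriv (tV2 t) x| ≤ (2 * M) * X := by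
  have tot : ∀ {a b c : ℝ}, |a| ≤ M → |b| ≤ M → |c| ≤ M → |b - c| ≤ X →
      BddDiff (2 * M) X (a + b) (a + c) := by
    intro a b c ha hb hc hbc
    refine ⟨(abs_add_le _ _).trans (by linarith), (abs_add_le _ _).trans (by linarith), ?_⟩
    rwa [add_sub_add_left_eq_sub]
  have hJ := tot (hsb.J x hx) (hb1.J t ht x hx) (hb2.J t ht x hx) hq
  have hE := tot (hsb.E x hx) (hb1.E t ht x hx) (hb2.E t ht x hx) he
  have hD := tot (hsb.nx x hx) (hb1.nx t ht x hx) (hb2.nx t ht x hx) hpx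
  have hS : BddDiff (s + M) |iteratedDeriv 2 (tn1 t) x - iteratedDeriv 2 (tn2 t) x|
      (iteratedDeriv 2 ns x + iteratedDeriv 2 (tn1 t) x)
      (iteratedDeriv 2 ns x + iteratedDeriv 2 (tn2 t) x) := by
    have := hsb.nxx x hx
    refine ⟨(abs_add_le _ _).trans (by linarith), (abs_add_le _ _).trans (by linarith), ?_⟩
    rw [add_sub_add_left_eq_sub]
  have hN : |(ns x + tn1 t x) - (ns x + tn2 t x)| ≤ X := by rwa [add_sub_add_left_eq_sub]
  obtain ⟨eP, eQ, eR, eS, eA⟩ := abs_flux_diff_le (by linarith : 1 ≤ 2 * M)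
    (by linarith : 1 ≤ s + M) (h1.npos t ht x hx) (h2.npos t ht x hx)
    ((hb1.inv t ht x hx).trans (by linarith)) ((hb2.inv t ht x hx).trans (by linarith)) hN
    hJ hE hD hS
  obtain ⟨d1, d2⟩ := deriv_add_of_contDiff hs.smooth_n (h1.reg_n t ht) x
  obtain ⟨d1', d2'⟩ := deriv_add_of_contDiff hs.smooth_n (h2.reg_n t ht) x
  have fV : BddDiff M X _ _ := ⟨hb1.Vx t ht x hx, hb2.Vx t ht x hx, hvx⟩
  have fF := (BddDiff.mul ⟨hb1.n t ht x hx, hb2.n t ht x hx, hp⟩ fV).2.2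
  have fG := (BddDiff.mul ⟨hb1.J t ht x hx, hb2.J t ht x hx, hq⟩ fV).2.2
  refine ⟨?_, ?_, ?_, ?_, ?_, fF.trans (by linarith), fG.trans (by linarith)⟩
  · convert eA using 2
    simp only [sourceA, d1, d2, d1', d2']
    ring
  · convert eP using 2
    simp only [fluxP]
    ring
  · have e : fluxQ ns Js Es (tn1 t) (tJ1 t) (tE1 t) x - fluxQ ns Js Es (tn2 t) (tJ2 t) (tE2 t) x
        = ((Js x + tJ1 t x) / (ns x + tn1 t x) * (Es x + tE1 t x)
          - (Js x + tJ2 t x) / (ns x + tn2 t x) * (Es x + tE2 t x))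
          - (3/2) * (tJ1 t x - tJ2 t x) := by
      simp only [fluxQ]; ring
    rw [e]
    refine (abs_sub _ _).trans ?_
    rw [abs_mul, abs_of_pos (by norm_num : (0:ℝ) < 3/2)]
    have : 0 ≤ X := (abs_nonneg _).trans hp
    linarith
  · convert eR using 2
    simp only [fluxR]
    ring
  · convert eS using 2
    simp only [fluxS, d1, d2, d1', d2']
    ring

end solution

section energy

variable {ν ε τ lam μ T Jb Vb : ℝ} {ρ ns Js Es Vs : ℝ → ℝ}
  {tn1 tJ1 tE1 tV1 tn2 tJ2 tE2 tV2 : ℝ → ℝ → ℝ}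

/-- The constant collecting all coefficients in the pointwise energy estimate. -/
def coeffBound (ε τ μ M : ℝ) : ℝ := 20 * (2 * M) ^ 6 + 2 * M + 2 + ε ^ 2 / 18 + 1 / τ + μ

/-- The constant in the absorbed energy estimate. -/
def absorbConst (ν κ a d : ℝ) : ℝ :=
  d ^ 2 / (4 * ν) + d ^ 2 / (2 * (a * ν)) + d ^ 2 / (2 * (κ * ν)) + d

/-- The sum of the lower order differences of two solutions. -/
def lowDiff (tn1 tJ1 tE1 tV1 tn2 tJ2 tE2 tV2 : ℝ → ℝ → ℝ) (t x : ℝ) : ℝ :=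
  |tn1 t x - tn2 t x| + |deriv (tn1 t) x - deriv (tn2 t) x| + |tJ1 t x - tJ2 t x|
    + |tE1 t x - tE2 t x| + |deriv (tV1 t) x - deriv (tV2 t) x|

/-- Half the time derivative of the energy density of the difference of two solutions, up to a
spatial divergence. -/
def energyRate (κ a : ℝ) (tn1 tJ1 tE1 tn2 tJ2 tE2 : ℝ → ℝ → ℝ) (t x : ℝ) : ℝ :=
  (tn1 t x - tn2 t x) * (tderiv tn1 t x - tderiv tn2 t x)
    - κ * ((iteratedDeriv 2 (tn1 t) x - iteratedDeriv 2 (tn2 t) x)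
      * (tderiv tn1 t x - tderiv tn2 t x))
    + (tJ1 t x - tJ2 t x) * (tderiv tJ1 t x - tderiv tJ2 t x)
    + a * ((tE1 t x - tE2 t x) * (tderiv tE1 t x - tderiv tE2 t x))

/-- The energy flux entering the divergence of the difference of two solutions. -/
def totalFlux (κ : ℝ) (ns Js Es : ℝ → ℝ) (tn1 tJ1 tE1 tn2 tJ2 tE2 : ℝ → ℝ → ℝ) (t x : ℝ) : ℝ :=
  -(5/3) * (fluxQ ns Js Es (tn1 t) (tJ1 t) (tE1 t) x - fluxQ ns Js Es (tn2 t) (tJ2 t) (tE2 t) x)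
    + (1/3) * (fluxR ns Js (tn1 t) (tJ1 t) x - fluxR ns Js (tn2 t) (tJ2 t) x)
    + κ * (fluxS ns Js (tn1 t) (tJ1 t) x - fluxS ns Js (tn2 t) (tJ2 t) x)

/-- The spatial boundary term of the energy identity. -/
def energyFlux (ν κ a : ℝ) (ns Js Es : ℝ → ℝ) (tn1 tJ1 tE1 tn2 tJ2 tE2 : ℝ → ℝ → ℝ)
    (t x : ℝ) : ℝ :=
  ν * ((tn1 t x - tn2 t x) * (deriv (tn1 t) x - deriv (tn2 t) x))
    + ν * ((tJ1 t x - tJ2 t x) * (deriv (tJ1 t) x - deriv (tJ2 t) x))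
    + κ * ((tJ1 t x - tJ2 t x) * (iteratedDeriv 2 (tn1 t) x - iteratedDeriv 2 (tn2 t) x))
    - (2/3) * ((tJ1 t x - tJ2 t x) *
      (fluxP ns Js (tn1 t) (tJ1 t) x - fluxP ns Js (tn2 t) (tJ2 t) x))
    + a * (ν * ((tE1 t x - tE2 t x) * (deriv (tE1 t) x - deriv (tE2 t) x))
      + (tE1 t x - tE2 t x) * totalFlux κ ns Js Es tn1 tJ1 tE1 tn2 tJ2 tE2 t x)

/-- The pointwise energy inequality in divergence form. -/
theorem exists_hasDerivAt_energyFlux (hν : 0 < ν) (hε : 0 < ε) (hτ : 0 < τ) (hμ : 0 < μ)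
    (hs : IsSteadySol ν ε τ lam μ Jb Vb ρ ns Js Es Vs)
    (h1 : IsPerturbSol ν ε τ lam μ T ns Js Es Vs tn1 tJ1 tE1 tV1)
    (h2 : IsPerturbSol ν ε τ lam μ T ns Js Es Vs tn2 tJ2 tE2 tV2)
    {M s a t x : ℝ} (hM : 1 ≤ M) (hsb : SteadyBound M ns Js Es Vs)
    (hb1 : LowBound T M ns tn1 tJ1 tE1 tV1) (hb2 : LowBound T M ns tn2 tJ2 tE2 tV2)
    (ha : 0 < a) (ha1 : a ≤ 1)
    (hac : a * (30 * coeffBound ε τ μ M ^ 2) ^ 2 ≤ ε ^ 2 / 18 * ν ^ 2)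
    (ht : t ∈ Icc (0:ℝ) T) (hx : x ∈ Icc (0:ℝ) 1) (hs1 : 1 ≤ s)
    (hxx1 : |iteratedDeriv 2 (tn1 t) x| ≤ s) (hxx2 : |iteratedDeriv 2 (tn2 t) x| ≤ s) :
    ∃ b, HasDerivAt (energyFlux ν (ε ^ 2 / 18) a ns Js Es tn1 tJ1 tE1 tn2 tJ2 tE2 t) b x ∧
      energyRate (ε ^ 2 / 18) a tn1 tJ1 tE1 tn2 tJ2 tE2 t x
        - absorbConst ν (ε ^ 2 / 18) a (30 * coeffBound ε τ μ M ^ 2) *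
          ((s + M) ^ 2 * lowDiff tn1 tJ1 tE1 tV1 tn2 tJ2 tE2 tV2 t x ^ 2) ≤ b := by
  set c := coeffBound ε τ μ M with hc
  set κ := ε ^ 2 / 18 with hκ
  set X := lowDiff tn1 tJ1 tE1 tV1 tn2 tJ2 tE2 tV2 t x with hX
  have hκ0 : 0 < κ := by positivity
  have hτ1 : 0 < 1 / τ := by positivity
  have h6 : 0 ≤ 20 * (2 * M) ^ 6 := by positivity
  have hcdef : c = 20 * (2 * M) ^ 6 + 2 * M + 2 + κ + 1 / τ + μ := rfl
  have l1 := abs_nonneg (tn1 t x - tn2 t x)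
  have l2 := abs_nonneg (deriv (tn1 t) x - deriv (tn2 t) x)
  have l3 := abs_nonneg (tJ1 t x - tJ2 t x)
  have l4 := abs_nonneg (tE1 t x - tE2 t x)
  have l5 := abs_nonneg (deriv (tV1 t) x - deriv (tV2 t) x)
  have hXdef : X = |tn1 t x - tn2 t x| + |deriv (tn1 t) x - deriv (tn2 t) x|
    + |tJ1 t x - tJ2 t x| + |tE1 t x - tE2 t x| + |deriv (tV1 t) x - deriv (tV2 t) x| := rfl
  have hX0 : 0 ≤ X := by linarith
  have m1 : |tn1 t x - tn2 t x| ≤ X := by linarith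
  have m2 : |deriv (tn1 t) x - deriv (tn2 t) x| ≤ X := by linarith
  have m3 : |tJ1 t x - tJ2 t x| ≤ X := by linarith
  have m4 : |tE1 t x - tE2 t x| ≤ X := by linarith
  have m5 : |deriv (tV1 t) x - deriv (tV2 t) x| ≤ X := by linarith
  obtain ⟨fA, fP, fQ, fR, fS, fF, fG⟩ := flux_sub_bounds hs h1 h2 hM hsb hb1 hb2 ht hx hs1 hxx1
    hxx2 m1 m2 m3 m4 m5
  have hc6 : 20 * (2 * M) ^ 6 ≤ c := by linarith
  have hc62 : 20 * (2 * M) ^ 6 + 2 ≤ c := by linarith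
  have hc2 : 2 * M ≤ c := by linarith
  have hc1 : 1 ≤ c := by linarith
  have hz : 0 ≤ (s + M) * X + |iteratedDeriv 2 (tn1 t) x - iteratedDeriv 2 (tn2 t) x| := by
    have := abs_nonneg (iteratedDeriv 2 (tn1 t) x - iteratedDeriv 2 (tn2 t) x)
    have : 0 ≤ (s + M) * X := mul_nonneg (by linarith) hX0
    linarith
  have key := remainder_le (qx := deriv (tJ1 t) x - deriv (tJ2 t) x)
    (ex := deriv (tE1 t) x - deriv (tE2 t) x) hν hκ0 hτ hμ ha ha1 hc1
    (by linarith : 1 ≤ s + M) (by linarith : κ ≤ c) (by linarith : 1 / τ ≤ c)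
    (by linarith : μ ≤ c) m1 m2 m3 m4 m5 ((hsb.n x hx).trans (by linarith))
    ((hsb.J x hx).trans (by linarith)) ((hsb.Vx x hx).trans (by linarith))
    (fA.trans (mul_le_mul_of_nonneg_right hc6 hz)) (fP.trans (mul_le_mul_of_nonneg_right hc6 hX0))
    (fQ.trans (mul_le_mul_of_nonneg_right hc62 hX0))
    (fR.trans (mul_le_mul_of_nonneg_right hc6 hX0)) (fS.trans (mul_le_mul_of_nonneg_right hc6 hz))
    (fF.trans (mul_le_mul_of_nonneg_right hc2 hX0)) (fG.trans (mul_le_mul_of_nonneg_right hc2 hX0))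
  have abs := absorb_le (X := X) (s := s + M) (Q := |deriv (tJ1 t) x - deriv (tJ2 t) x|)
    (W := |deriv (tE1 t) x - deriv (tE2 t) x|)
    (Z := |iteratedDeriv 2 (tn1 t) x - iteratedDeriv 2 (tn2 t) x|) hν hκ0 ha hac (by positivity)
    (by linarith)
  have key := key.trans abs
  have dn0 : ∀ {f : ℝ → ℝ}, ContDiff ℝ 4 f → HasDerivAt f (deriv f x) x := fun hf =>
    (hf.differentiable (by norm_num) x).hasDerivAt
  have dJ0 : ∀ {f : ℝ → ℝ}, ContDiff ℝ 3 f → HasDerivAt f (deriv f x) x := fun hf =>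
    (hf.differentiable (by norm_num) x).hasDerivAt
  have dfl : ∀ {f n : ℝ → ℝ}, IsOpen (posSet ns n) → Icc (0:ℝ) 1 ⊆ posSet ns n →
      ContDiffOn ℝ 2 f (posSet ns n) → HasDerivAt f (deriv f x) x := fun hO hU hf =>
    ((hf.contDiffAt (hO.mem_nhds (hU hx))).differentiableAt (by norm_num)).hasDerivAt
  have n1 := h1.reg_n t ht
  have n2 := h2.reg_n t ht
  have J1 := h1.reg_J t ht
  have J2 := h2.reg_J t ht
  have E1 := h1.reg_E t ht
  have E2 := h2.reg_E t ht
  have U1 := h1.subset_posSet hs ht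
  have U2 := h2.subset_posSet hs ht
  have O1 := h1.isOpen_posSet hs ht
  have O2 := h2.isOpen_posSet hs ht
  have vp := (dn0 n1).sub (dn0 n2)
  have vpx := (n1.hasDerivAt_deriv_two (k := 4) (by norm_num) x).sub
    (n2.hasDerivAt_deriv_two (k := 4) (by norm_num) x)
  have vpxx := (n1.hasDerivAt_iteratedDeriv (k := 4) (i := 2) (by norm_num) x).sub
    (n2.hasDerivAt_iteratedDeriv (k := 4) (i := 2) (by norm_num) x)
  have vq := (dJ0 J1).sub (dJ0 J2)
  have vqx := (J1.hasDerivAt_deriv_two (k := 3) (by norm_num) x).sub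
    (J2.hasDerivAt_deriv_two (k := 3) (by norm_num) x)
  have ve := (dJ0 E1).sub (dJ0 E2)
  have vex := (E1.hasDerivAt_deriv_two (k := 3) (by norm_num) x).sub
    (E2.hasDerivAt_deriv_two (k := 3) (by norm_num) x)
  have vP := (dfl O1 U1 (contDiffOn_fluxP hs.smooth_n hs.smooth_J n1 J1)).sub
    (dfl O2 U2 (contDiffOn_fluxP hs.smooth_n hs.smooth_J n2 J2))
  have vQ := (dfl O1 U1 (contDiffOn_fluxQ hs.smooth_n hs.smooth_J hs.smooth_E n1 J1 E1)).sub
    (dfl O2 U2 (contDiffOn_fluxQ hs.smooth_n hs.smooth_J hs.smooth_E n2 J2 E2))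
  have vR := (dfl O1 U1 (contDiffOn_fluxR hs.smooth_n hs.smooth_J n1 J1)).sub
    (dfl O2 U2 (contDiffOn_fluxR hs.smooth_n hs.smooth_J n2 J2))
  have vS := (dfl O1 U1 (contDiffOn_fluxS hs.smooth_n hs.smooth_J n1 J1)).sub
    (dfl O2 U2 (contDiffOn_fluxS hs.smooth_n hs.smooth_J n2 J2))
  have vW := ((vQ.const_mul (-(5/3))).add (vR.const_mul (1/3))).add (vS.const_mul κ)
  refine ⟨_, (((((vp.mul vpx).const_mul ν).add ((vq.mul vqx).const_mul ν)).add
    ((vq.mul vpxx).const_mul κ)).sub ((vq.mul vP).const_mul (2/3))).add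
    ((((ve.mul vex).const_mul ν).add (ve.mul vW)).const_mul a), ?_⟩
  have q11 := h1.eq1 t ht x hx
  have q12 := h2.eq1 t ht x hx
  have q21 := h1.eq2 t ht x hx
  have q22 := h2.eq2 t ht x hx
  have q31 := h1.eq3 t ht x hx
  have q32 := h2.eq3 t ht x hx
  rw [g1fun_eq] at q21 q22
  rw [g2fun_eq] at q31 q32
  rw [← hκ] at q21 q22 q31 q32
  clear_value c κ X
  simp only [energyRate, absorbConst, Pi.sub_apply, Pi.add_apply]
  linear_combination key + (tn1 t x - tn2 t x
      - κ * (iteratedDeriv 2 (tn1 t) x - iteratedDeriv 2 (tn2 t) x)) * (q11 - q12)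
    + (tJ1 t x - tJ2 t x) * (q21 - q22) + a * (tE1 t x - tE2 t x) * (q31 - q32)

end energy

section energy

variable {ν ε τ lam μ T Jb Vb : ℝ} {ρ ns Js Es Vs : ℝ → ℝ}
  {tn1 tJ1 tE1 tV1 tn2 tJ2 tE2 tV2 : ℝ → ℝ → ℝ}

/-- The energy density of the difference of two solutions. -/
def energyDensity (κ a : ℝ) (tn1 tJ1 tE1 tn2 tJ2 tE2 : ℝ → ℝ → ℝ) (t x : ℝ) : ℝ :=
  (tn1 t x - tn2 t x) ^ 2 + κ * (deriv (tn1 t) x - deriv (tn2 t) x) ^ 2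
    + (tJ1 t x - tJ2 t x) ^ 2 + a * (tE1 t x - tE2 t x) ^ 2

theorem energyFlux_eq_zero {κ a x : ℝ}
    (h1 : IsPerturbSol ν ε τ lam μ T ns Js Es Vs tn1 tJ1 tE1 tV1)
    (h2 : IsPerturbSol ν ε τ lam μ T ns Js Es Vs tn2 tJ2 tE2 tV2) {t : ℝ}
    (ht : t ∈ Icc (0:ℝ) T) (hx : x = 0 ∨ x = 1) :
    energyFlux ν κ a ns Js Es tn1 tJ1 tE1 tn2 tJ2 tE2 t x = 0 := by
  have a1 := h1.bc_n t ht 0 (by norm_num)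
  have a2 := h2.bc_n t ht 0 (by norm_num)
  have b1 := h1.bc_JE t ht 0 (by norm_num)
  have b2 := h2.bc_JE t ht 0 (by norm_num)
  simp only [iteratedDeriv_zero] at a1 a2 b1 b2
  rcases hx with rfl | rfl
  · simp [energyFlux, a1, a2, b1, b2]
  · simp [energyFlux, a1, a2, b1, b2]

theorem continuous_energyDensity {κ a : ℝ}
    (h1 : IsPerturbSol ν ε τ lam μ T ns Js Es Vs tn1 tJ1 tE1 tV1)
    (h2 : IsPerturbSol ν ε τ lam μ T ns Js Es Vs tn2 tJ2 tE2 tV2) {t : ℝ}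
    (ht : t ∈ Icc (0:ℝ) T) : Continuous (energyDensity κ a tn1 tJ1 tE1 tn2 tJ2 tE2 t) := by
  have n1 := (h1.reg_n t ht).continuous
  have n2 := (h2.reg_n t ht).continuous
  have d1 := (h1.reg_n t ht).continuous_deriv (by norm_num)
  have d2 := (h2.reg_n t ht).continuous_deriv (by norm_num)
  have J1 := (h1.reg_J t ht).continuous
  have J2 := (h2.reg_J t ht).continuous
  have E1 := (h1.reg_E t ht).continuous
  have E2 := (h2.reg_E t ht).continuous
  unfold energyDensity
  fun_prop

theorem continuousOn_energyRate {κ a : ℝ}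
    (hs : IsSteadySol ν ε τ lam μ Jb Vb ρ ns Js Es Vs)
    (h1 : IsPerturbSol ν ε τ lam μ T ns Js Es Vs tn1 tJ1 tE1 tV1)
    (h2 : IsPerturbSol ν ε τ lam μ T ns Js Es Vs tn2 tJ2 tE2 tV2) {t : ℝ}
    (ht : t ∈ Icc (0:ℝ) T) :
    ContinuousOn (energyRate κ a tn1 tJ1 tE1 tn2 tJ2 tE2 t) (Icc 0 1) := by
  have n1 := (h1.reg_n t ht).continuous.continuousOn (s := Icc (0:ℝ) 1)
  have n2 := (h2.reg_n t ht).continuous.continuousOn (s := Icc (0:ℝ) 1)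
  have d1 := ((h1.reg_n t ht).continuous_iteratedDeriv 2 (by norm_num)).continuousOn
    (s := Icc (0:ℝ) 1)
  have d2 := ((h2.reg_n t ht).continuous_iteratedDeriv 2 (by norm_num)).continuousOn
    (s := Icc (0:ℝ) 1)
  have J1 := (h1.reg_J t ht).continuous.continuousOn (s := Icc (0:ℝ) 1)
  have J2 := (h2.reg_J t ht).continuous.continuousOn (s := Icc (0:ℝ) 1)
  have E1 := (h1.reg_E t ht).continuous.continuousOn (s := Icc (0:ℝ) 1)
  have E2 := (h2.reg_E t ht).continuous.continuousOn (s := Icc (0:ℝ) 1)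
  obtain ⟨a1, a2, a3⟩ := h1.contDiffOn_tderiv hs ht
  obtain ⟨b1, b2, b3⟩ := h2.contDiffOn_tderiv hs ht
  have a1 := a1.continuousOn
  have a2 := a2.continuousOn
  have a3 := a3.continuousOn
  have b1 := b1.continuousOn
  have b2 := b2.continuousOn
  have b3 := b3.continuousOn
  exact ((((n1.sub n2).mul (a1.sub b1)).sub (((d1.sub d2).mul (a1.sub b1)).const_mul κ)).add
    ((J1.sub J2).mul (a2.sub b2))).add (((E1.sub E2).mul (a3.sub b3)).const_mul a)

/-- The potential difference is controlled by the density difference. -/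
theorem sq_deriv_potential_sub_le (hlam : 0 < lam)
    (h1 : IsPerturbSol ν ε τ lam μ T ns Js Es Vs tn1 tJ1 tE1 tV1)
    (h2 : IsPerturbSol ν ε τ lam μ T ns Js Es Vs tn2 tJ2 tE2 tV2) {t x : ℝ}
    (ht : t ∈ Icc (0:ℝ) T) (hx : x ∈ Icc (0:ℝ) 1) :
    (deriv (tV1 t) x - deriv (tV2 t) x) ^ 2
      ≤ 1 / lam ^ 4 * ∫ y in (0:ℝ)..1, (tn1 t y - tn2 t y) ^ 2 := by
  have V1 := h1.reg_V t ht
  have V2 := h2.reg_V t ht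
  have key := sq_sub_le_integral_sq_deriv (f := fun x => deriv (tV1 t) x - deriv (tV2 t) x)
    (φ := fun x => iteratedDeriv 2 (tV1 t) x - iteratedDeriv 2 (tV2 t) x)
    ((V1.continuous_deriv (by norm_num)).sub (V2.continuous_deriv (by norm_num))).continuousOn
    ((V1.continuous_iteratedDeriv 2 (by norm_num)).sub
      (V2.continuous_iteratedDeriv 2 (by norm_num))).continuousOn
    (fun x _ => (V1.hasDerivAt_deriv_two (k := 6) (by norm_num) x).sub
      (V2.hasDerivAt_deriv_two (k := 6) (by norm_num) x)) hx (left_mem_Icc.2 zero_le_one)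
  simp only [(h1.bc_V t ht).2.2.1, (h2.bc_V t ht).2.2.1, sub_zero] at key
  refine key.trans (le_of_eq ?_)
  rw [← intervalIntegral.integral_const_mul]
  refine integral_congr_Ioo zero_le_one fun y hy => ?_
  have e1 := h1.eq4 t ht y (Ioo_subset_Icc_self hy)
  have e2 := h2.eq4 t ht y (Ioo_subset_Icc_self hy)
  have : tn1 t y - tn2 t y = lam ^ 2 * (iteratedDeriv 2 (tV1 t) y - iteratedDeriv 2 (tV2 t) y) := by
    linarith
  rw [this]
  field_simp

theorem integral_sq_lowDiff_le {κ a : ℝ} (hκ : 0 < κ) (ha : 0 < a) (hlam : 0 < lam)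
    (h1 : IsPerturbSol ν ε τ lam μ T ns Js Es Vs tn1 tJ1 tE1 tV1)
    (h2 : IsPerturbSol ν ε τ lam μ T ns Js Es Vs tn2 tJ2 tE2 tV2) {t : ℝ}
    (ht : t ∈ Icc (0:ℝ) T) :
    ∫ x in (0:ℝ)..1, lowDiff tn1 tJ1 tE1 tV1 tn2 tJ2 tE2 tV2 t x ^ 2
      ≤ 5 * (1 + 1 / κ + 1 / a + 1 / lam ^ 4) *
        ∫ x in (0:ℝ)..1, energyDensity κ a tn1 tJ1 tE1 tn2 tJ2 tE2 t x := by
  set F := ∫ x in (0:ℝ)..1, energyDensity κ a tn1 tJ1 tE1 tn2 tJ2 tE2 t x with hF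
  have cE := continuous_energyDensity (κ := κ) (a := a) h1 h2 ht
  have n1 := (h1.reg_n t ht).continuous
  have n2 := (h2.reg_n t ht).continuous
  have cL : Continuous fun x => lowDiff tn1 tJ1 tE1 tV1 tn2 tJ2 tE2 tV2 t x ^ 2 := by
    have d1 := (h1.reg_n t ht).continuous_deriv (by norm_num)
    have d2 := (h2.reg_n t ht).continuous_deriv (by norm_num)
    have J1 := (h1.reg_J t ht).continuous
    have J2 := (h2.reg_J t ht).continuous
    have E1 := (h1.reg_E t ht).continuous
    have E2 := (h2.reg_E t ht).continuous
    have V1 := (h1.reg_V t ht).continuous_deriv (by norm_num)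
    have V2 := (h2.reg_V t ht).continuous_deriv (by norm_num)
    unfold lowDiff
    fun_prop
  have hpF : ∫ y in (0:ℝ)..1, (tn1 t y - tn2 t y) ^ 2 ≤ F := by
    refine intervalIntegral.integral_mono_on zero_le_one
      (Continuous.intervalIntegrable (by fun_prop) _ _) (cE.intervalIntegrable _ _) fun x _ => ?_
    have : 0 ≤ κ * (deriv (tn1 t) x - deriv (tn2 t) x) ^ 2 := by positivity
    have : 0 ≤ a * (tE1 t x - tE2 t x) ^ 2 := by positivity
    have : 0 ≤ (tJ1 t x - tJ2 t x) ^ 2 := by positivity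
    simp only [energyDensity]
    linarith
  have hl : 0 < 1 / lam ^ 4 := by positivity
  have hpt : ∀ x ∈ Icc (0:ℝ) 1, lowDiff tn1 tJ1 tE1 tV1 tn2 tJ2 tE2 tV2 t x ^ 2
      ≤ 5 * (1 + 1 / κ + 1 / a) * energyDensity κ a tn1 tJ1 tE1 tn2 tJ2 tE2 t x
        + 5 * (1 / lam ^ 4) * F := by
    intro x hx
    have hv := (sq_deriv_potential_sub_le hlam h1 h2 ht hx).trans
      (mul_le_mul_of_nonneg_left hpF hl.le)
    have five : ∀ a b c d e : ℝ, (|a| + |b| + |c| + |d| + |e|) ^ 2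
        ≤ 5 * (a ^ 2 + b ^ 2 + c ^ 2 + d ^ 2 + e ^ 2) := by
      intro a b c d e
      rw [← sq_abs a, ← sq_abs b, ← sq_abs c, ← sq_abs d, ← sq_abs e]
      have h : ∀ z : ℝ, 0 ≤ z ^ 2 := sq_nonneg
      linear_combination h (|a| - |b|) + h (|a| - |c|) + h (|a| - |d|) + h (|a| - |e|)
        + h (|b| - |c|) + h (|b| - |d|) + h (|b| - |e|) + h (|c| - |d|) + h (|c| - |e|)
        + h (|d| - |e|)
    have hdens : ∀ p r q e : ℝ, p ^ 2 + r ^ 2 + q ^ 2 + e ^ 2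
        ≤ (1 + 1 / κ + 1 / a) * (p ^ 2 + κ * r ^ 2 + q ^ 2 + a * e ^ 2) := by
      intro p r q e
      have i1 : (1 + 1 / κ + 1 / a) * (p ^ 2 + κ * r ^ 2 + q ^ 2 + a * e ^ 2)
          - (p ^ 2 + r ^ 2 + q ^ 2 + e ^ 2)
          = κ * r ^ 2 + a * e ^ 2 + 1 / κ * (p ^ 2 + q ^ 2 + a * e ^ 2)
            + 1 / a * (p ^ 2 + q ^ 2 + κ * r ^ 2) := by
        field_simp
        ring
      have : 0 ≤ κ * r ^ 2 + a * e ^ 2 + 1 / κ * (p ^ 2 + q ^ 2 + a * e ^ 2)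
            + 1 / a * (p ^ 2 + q ^ 2 + κ * r ^ 2) := by positivity
      linarith
    have A := five (tn1 t x - tn2 t x) (deriv (tn1 t) x - deriv (tn2 t) x) (tJ1 t x - tJ2 t x)
      (tE1 t x - tE2 t x) (deriv (tV1 t) x - deriv (tV2 t) x)
    have B := hdens (tn1 t x - tn2 t x) (deriv (tn1 t) x - deriv (tn2 t) x) (tJ1 t x - tJ2 t x)
      (tE1 t x - tE2 t x)
    simp only [lowDiff, energyDensity]
    linarith
  refine (intervalIntegral.integral_mono_on zero_le_one (cL.intervalIntegrable _ _)
    (Continuous.intervalIntegrable (by fun_prop) _ _) hpt).trans (le_of_eq ?_)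
  rw [intervalIntegral.integral_add ((cE.const_mul _).intervalIntegrable _ _)
    intervalIntegrable_const, intervalIntegral.integral_const_mul, ← hF,
    intervalIntegral.integral_const]
  simp only [sub_zero, one_smul]
  ring

theorem integral_energyRate_le (hν : 0 < ν) (hε : 0 < ε) (hτ : 0 < τ) (hμ : 0 < μ)
    (hlam : 0 < lam)
    (hs : IsSteadySol ν ε τ lam μ Jb Vb ρ ns Js Es Vs)
    (h1 : IsPerturbSol ν ε τ lam μ T ns Js Es Vs tn1 tJ1 tE1 tV1)
    (h2 : IsPerturbSol ν ε τ lam μ T ns Js Es Vs tn2 tJ2 tE2 tV2)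
    {M s a t : ℝ} (hM : 1 ≤ M) (hsb : SteadyBound M ns Js Es Vs)
    (hb1 : LowBound T M ns tn1 tJ1 tE1 tV1) (hb2 : LowBound T M ns tn2 tJ2 tE2 tV2)
    (ha : 0 < a) (ha1 : a ≤ 1)
    (hac : a * (30 * coeffBound ε τ μ M ^ 2) ^ 2 ≤ ε ^ 2 / 18 * ν ^ 2)
    (ht : t ∈ Icc (0:ℝ) T) (hs1 : 1 ≤ s)
    (hxx1 : ∀ x ∈ Icc (0:ℝ) 1, |iteratedDeriv 2 (tn1 t) x| ≤ s)
    (hxx2 : ∀ x ∈ Icc (0:ℝ) 1, |iteratedDeriv 2 (tn2 t) x| ≤ s) :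
    ∫ x in (0:ℝ)..1, energyRate (ε ^ 2 / 18) a tn1 tJ1 tE1 tn2 tJ2 tE2 t x
      ≤ absorbConst ν (ε ^ 2 / 18) a (30 * coeffBound ε τ μ M ^ 2) * (s + M) ^ 2 *
        (5 * (1 + 1 / (ε ^ 2 / 18) + 1 / a + 1 / lam ^ 4) *
          ∫ x in (0:ℝ)..1, energyDensity (ε ^ 2 / 18) a tn1 tJ1 tE1 tn2 tJ2 tE2 t x) := by
  have hκ : 0 < ε ^ 2 / 18 := by positivity
  have hτ1 : 0 < 1 / τ := by positivity
  have key := fun x (hx : x ∈ Icc (0:ℝ) 1) => exists_hasDerivAt_energyFlux hν hε hτ hμ hs h1 h2 hM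
    hsb hb1 hb2 ha ha1 hac ht hx hs1 (hxx1 x hx) (hxx2 x hx)
  choose! b hb hle using key
  have cR := continuousOn_energyRate (κ := ε ^ 2 / 18) (a := a) hs h1 h2 ht
  have cL : Continuous (lowDiff tn1 tJ1 tE1 tV1 tn2 tJ2 tE2 tV2 t) := by
    have n1 := (h1.reg_n t ht).continuous
    have n2 := (h2.reg_n t ht).continuous
    have d1 := (h1.reg_n t ht).continuous_deriv (by norm_num)
    have d2 := (h2.reg_n t ht).continuous_deriv (by norm_num)
    have J1 := (h1.reg_J t ht).continuous
    have J2 := (h2.reg_J t ht).continuous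
    have E1 := (h1.reg_E t ht).continuous
    have E2 := (h2.reg_E t ht).continuous
    have V1 := (h1.reg_V t ht).continuous_deriv (by norm_num)
    have V2 := (h2.reg_V t ht).continuous_deriv (by norm_num)
    unfold lowDiff
    fun_prop
  have cL2 : Continuous fun x => absorbConst ν (ε ^ 2 / 18) a (30 * coeffBound ε τ μ M ^ 2) *
      ((s + M) ^ 2 * lowDiff tn1 tJ1 tE1 tV1 tn2 tJ2 tE2 tV2 t x ^ 2) := by fun_prop
  have hintegral := intervalIntegral.integral_le_sub_of_hasDeriv_right_of_le zero_le_one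
    (fun x hx => (hb x hx).continuousAt.continuousWithinAt)
    (fun x hx => (hb x (Ioo_subset_Icc_self hx)).hasDerivWithinAt)
    ((cR.sub cL2.continuousOn).integrableOn_Icc)
    (fun x hx => hle x (Ioo_subset_Icc_self hx))
  simp only [Pi.sub_apply] at hintegral
  rw [energyFlux_eq_zero h1 h2 ht (Or.inl rfl), energyFlux_eq_zero h1 h2 ht (Or.inr rfl),
    intervalIntegral.integral_sub (cR.intervalIntegrable_of_Icc zero_le_one)
      (cL2.intervalIntegrable _ _), intervalIntegral.integral_const_mul,
    intervalIntegral.integral_const_mul] at hintegral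
  have hA : 0 ≤ absorbConst ν (ε ^ 2 / 18) a (30 * coeffBound ε τ μ M ^ 2) * (s + M) ^ 2 := by
    unfold absorbConst
    positivity
  have := mul_le_mul_of_nonneg_left (integral_sq_lowDiff_le hκ ha hlam h1 h2 ht) hA
  linarith

end energy

theorem abs_sq_sub_sq_le {a b B δ : ℝ} (ha : |a| ≤ B) (hb : |b| ≤ B) (h : |a - b| ≤ δ) :
    |a ^ 2 - b ^ 2| ≤ 2 * B * δ := by
  have e : a ^ 2 - b ^ 2 = (a + b) * (a - b) := by ring
  have h1 : |a + b| ≤ 2 * B := (abs_add_le a b).trans (by linarith)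
  rw [e, abs_mul]
  exact mul_le_mul h1 h (abs_nonneg _) ((abs_nonneg _).trans h1)

theorem hasDerivAt_integral_sq {w : ℝ → ℝ → ℝ} {w' G : ℝ → ℝ} {B C g T t : ℝ}
    (hw : ∀ s ∈ Icc (0:ℝ) T, ContinuousOn (w s) (Icc (0:ℝ) 1))
    (hB : ∀ s ∈ Icc (0:ℝ) T, ∀ x ∈ Icc (0:ℝ) 1, |w s x| ≤ B)
    (hlip : ∀ s ∈ Icc (0:ℝ) T, ∀ x ∈ Icc (0:ℝ) 1, |w s x - w t x| ≤ C * |G s - G t|)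
    (ht : t ∈ Ioo (0:ℝ) T) (hG : HasDerivAt G g t)
    (hd : ∀ x ∈ Icc (0:ℝ) 1, HasDerivAt (fun s => w s x) (w' x) t)
    (hw' : ContinuousOn w' (Icc (0:ℝ) 1)) :
    HasDerivAt (fun s => ∫ x in (0:ℝ)..1, w s x ^ 2) (∫ x in (0:ℝ)..1, 2 * (w t x * w' x)) t := by
  have htT := Ioo_subset_Icc_self ht
  refine hasDerivAt_integral_of_abs_sub_le (w := fun s x => w s x ^ 2) (C := 2 * B * C)
    (fun s hs => (hw s hs).pow 2) (fun s hs x hx => ?_) ht hG (fun x hx => ?_)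
    (((hw t htT).mul hw').const_mul 2)
  · rw [mul_assoc]
    exact abs_sq_sub_sq_le (hB s hs x hx) (hB t htT x hx) (hlip s hs x hx)
  · have h := (hd x hx).fun_pow 2
    rw [Nat.cast_ofNat, pow_one, mul_assoc] at h
    exact h

/-- The time derivative of the squared `L²` norm of a space derivative, integrated by parts. -/
theorem hasDerivAt_integral_sq_deriv {u ux : ℝ → ℝ → ℝ} {uxx ut G : ℝ → ℝ} {C g T t : ℝ}
    (hu0 : ∀ s ∈ Icc (0:ℝ) T, u s 0 = 0 ∧ u s 1 = 0)
    (hu : ∀ s ∈ Icc (0:ℝ) T, ∀ x ∈ Icc (0:ℝ) 1, HasDerivAt (u s) (ux s x) x)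
    (hux : ∀ s ∈ Icc (0:ℝ) T, ContinuousOn (ux s) (Icc (0:ℝ) 1))
    (huxx : ∀ x ∈ Icc (0:ℝ) 1, HasDerivAt (ux t) (uxx x) x)
    (huxxc : ContinuousOn uxx (Icc (0:ℝ) 1))
    (hlip : ∀ s ∈ Icc (0:ℝ) T, ∀ x ∈ Icc (0:ℝ) 1, |u s x - u t x| ≤ C * |G s - G t|)
    (hlipx : ∀ s ∈ Icc (0:ℝ) T, ∀ x ∈ Icc (0:ℝ) 1, |ux s x - ux t x| ≤ C * |G s - G t|)
    (ht : t ∈ Ioo (0:ℝ) T) (hG : HasDerivAt G g t)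
    (hd : ∀ x ∈ Icc (0:ℝ) 1, HasDerivAt (fun s => u s x) (ut x) t)
    (hut : ContinuousOn ut (Icc (0:ℝ) 1)) :
    HasDerivAt (fun s => ∫ x in (0:ℝ)..1, ux s x ^ 2)
      (-∫ x in (0:ℝ)..1, 2 * (uxx x * ut x)) t := by
  have htT := Ioo_subset_Icc_self ht
  have huc : ∀ s ∈ Icc (0:ℝ) T, ContinuousOn (u s) (Icc (0:ℝ) 1) := fun s hs x hx =>
    (hu s hs x hx).continuousAt.continuousWithinAt
  obtain ⟨B, hB⟩ := isCompact_Icc.exists_bound_of_continuousOn huxxc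
  have hcross : HasDerivAt (fun s => ∫ x in (0:ℝ)..1, 2 * (uxx x * (u s x - u t x)))
      (∫ x in (0:ℝ)..1, 2 * (uxx x * ut x)) t := by
    refine hasDerivAt_integral_of_abs_sub_le (C := 2 * (B * C))
      (w := fun s x => 2 * (uxx x * (u s x - u t x)))
      (fun s hs => (huxxc.mul ((huc s hs).sub (huc t htT))).const_mul 2)
      (fun s hs x hx => ?_) ht hG (fun x hx => ?_) ((huxxc.mul hut).const_mul 2)
    · have e : 2 * (uxx x * (u s x - u t x)) - 2 * (uxx x * (u t x - u t x))
          = 2 * (uxx x * (u s x - u t x)) := by ring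
      rw [e, abs_mul, abs_mul, abs_two, mul_assoc, mul_assoc]
      exact mul_le_mul_of_nonneg_left (mul_le_mul (hB x hx) (hlip s hs x hx) (abs_nonneg _)
        ((norm_nonneg _).trans (hB x hx))) zero_le_two
    · exact (((hd x hx).sub_const _).const_mul _).const_mul _
  have hrem : HasDerivAt (fun s => ∫ x in (0:ℝ)..1, (ux s x - ux t x) ^ 2) 0 t := by
    refine hasDerivAt_zero_of_abs_le_sq (hG.const_mul C) (by simp) ?_
    filter_upwards [Icc_mem_nhds ht.1 ht.2] with s hs
    have := intervalIntegral.norm_integral_le_of_norm_le_const (a := (0:ℝ)) (b := 1)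
      (f := fun x => (ux s x - ux t x) ^ 2) (C := (C * G s - C * G t) ^ 2) fun x hx => by
        rw [uIoc_of_le zero_le_one] at hx
        have h1 := hlipx s hs x (Ioc_subset_Icc_self hx)
        rw [Real.norm_eq_abs, abs_pow, ← mul_sub, mul_pow, ← sq_abs (G s - G t), ← mul_pow]
        exact pow_le_pow_left₀ (abs_nonneg _) h1 2
    simpa [Real.norm_eq_abs] using this
  have hsum := ((hcross.const_sub (∫ x in (0:ℝ)..1, ux t x ^ 2)).add hrem)
  rw [add_zero] at hsum
  refine hsum.congr_of_eventuallyEq ?_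
  filter_upwards [Icc_mem_nhds ht.1 ht.2] with s hs
  have hi : uIcc (0:ℝ) 1 = Icc 0 1 := uIcc_of_le zero_le_one
  have hI : ∀ f : ℝ → ℝ, ContinuousOn f (Icc 0 1) → IntervalIntegrable f volume 0 1 :=
    fun f hf => hf.intervalIntegrable_of_Icc zero_le_one
  have hparts := intervalIntegral.integral_mul_deriv_eq_deriv_mul (a := (0:ℝ)) (b := 1)
    (u := ux t) (u' := uxx) (v := fun x => u s x - u t x) (v' := fun x => ux s x - ux t x)
    (fun x hx => huxx x (hi ▸ hx))
    (fun x hx => (hu s hs x (hi ▸ hx)).sub (hu t htT x (hi ▸ hx)))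
    (hI _ huxxc) (hI _ ((hux s hs).sub (hux t htT)))
  rw [(hu0 s hs).1, (hu0 s hs).2, (hu0 t htT).1, (hu0 t htT).2] at hparts
  simp only [sub_zero, mul_zero, zero_sub] at hparts
  have e : ∀ x, ux s x ^ 2
      = ux t x ^ 2 + 2 * (ux t x * (ux s x - ux t x)) + (ux s x - ux t x) ^ 2 := fun x => by ring
  have c1 := hI (fun x => ux t x ^ 2) ((hux t htT).pow 2)
  have c2 := hI (fun x => 2 * (ux t x * (ux s x - ux t x)))
    (((hux t htT).mul ((hux s hs).sub (hux t htT))).const_mul 2)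
  have c3 := hI (fun x => (ux s x - ux t x) ^ 2) (((hux s hs).sub (hux t htT)).pow 2)
  simp only [Pi.add_apply]
  rw [intervalIntegral.integral_congr (g := fun x => ux t x ^ 2
    + 2 * (ux t x * (ux s x - ux t x)) + (ux s x - ux t x) ^ 2) fun x _ => e x,
    intervalIntegral.integral_add (c1.add c2) c3, intervalIntegral.integral_add c1 c2,
    intervalIntegral.integral_const_mul, hparts, intervalIntegral.integral_const_mul]
  ring

section energy

variable {ν ε τ lam μ T Jb Vb : ℝ} {ρ ns Js Es Vs : ℝ → ℝ}
  {tn1 tJ1 tE1 tV1 tn2 tJ2 tE2 tV2 : ℝ → ℝ → ℝ}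

/-- The increments in time of the difference of two solutions. -/
theorem abs_diff_sub_le
    (h1 : IsPerturbSol ν ε τ lam μ T ns Js Es Vs tn1 tJ1 tE1 tV1)
    (h2 : IsPerturbSol ν ε τ lam μ T ns Js Es Vs tn2 tJ2 tE2 tV2) {k : ℝ → ℝ}
    (hk : IntervalIntegrable k volume 0 T) (hr1 : HasRate T tn1 tJ1 tE1 k)
    (hr2 : HasRate T tn2 tJ2 tE2 k) {s t x : ℝ}
    (hs : s ∈ Icc (0:ℝ) T) (ht : t ∈ Icc (0:ℝ) T) (hx : x ∈ Icc (0:ℝ) 1) :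
    |(tn1 t x - tn2 t x) - (tn1 s x - tn2 s x)|
      ≤ 2 * |(∫ r in (0:ℝ)..t, k r) - ∫ r in (0:ℝ)..s, k r| ∧
    |(tJ1 t x - tJ2 t x) - (tJ1 s x - tJ2 s x)|
      ≤ 2 * |(∫ r in (0:ℝ)..t, k r) - ∫ r in (0:ℝ)..s, k r| ∧
    |(tE1 t x - tE2 t x) - (tE1 s x - tE2 s x)|
      ≤ 2 * |(∫ r in (0:ℝ)..t, k r) - ∫ r in (0:ℝ)..s, k r| ∧
    |(deriv (tn1 t) x - deriv (tn2 t) x) - (deriv (tn1 s) x - deriv (tn2 s) x)|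
      ≤ 2 * |(∫ r in (0:ℝ)..t, k r) - ∫ r in (0:ℝ)..s, k r| := by
  have key : ∀ {a b c d z : ℝ}, |a - c| ≤ z → |b - d| ≤ z → |(a - b) - (c - d)| ≤ 2 * z := by
    intro a b c d z h h'
    have e : (a - b) - (c - d) = (a - c) - (b - d) := by ring
    rw [e]
    exact (abs_sub _ _).trans (by linarith)
  obtain ⟨a1, a2, a3, a4⟩ := h1.abs_sub_le hk hr1 hs ht hx
  obtain ⟨b1, b2, b3, b4⟩ := h2.abs_sub_le hk hr2 hs ht hx
  exact ⟨key a1 b1, key a2 b2, key a3 b3, key a4 b4⟩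

theorem LowBound.abs_diff_le {M : ℝ} (hb1 : LowBound T M ns tn1 tJ1 tE1 tV1)
    (hb2 : LowBound T M ns tn2 tJ2 tE2 tV2) {t x : ℝ}
    (ht : t ∈ Icc (0:ℝ) T) (hx : x ∈ Icc (0:ℝ) 1) :
    |tn1 t x - tn2 t x| ≤ 2 * M ∧ |tJ1 t x - tJ2 t x| ≤ 2 * M ∧ |tE1 t x - tE2 t x| ≤ 2 * M ∧
      |deriv (tn1 t) x - deriv (tn2 t) x| ≤ 2 * M := by
  have key : ∀ {a b : ℝ}, |a| ≤ M → |b| ≤ M → |a - b| ≤ 2 * M := fun h h' =>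
    (abs_sub _ _).trans (by linarith)
  exact ⟨key (hb1.n t ht x hx) (hb2.n t ht x hx), key (hb1.J t ht x hx) (hb2.J t ht x hx),
    key (hb1.E t ht x hx) (hb2.E t ht x hx), key (hb1.nx t ht x hx) (hb2.nx t ht x hx)⟩

theorem absolutelyContinuous_energy {κ a M : ℝ} (hT : 0 ≤ T) (hκ : 0 ≤ κ) (ha : 0 ≤ a)
    (h1 : IsPerturbSol ν ε τ lam μ T ns Js Es Vs tn1 tJ1 tE1 tV1)
    (h2 : IsPerturbSol ν ε τ lam μ T ns Js Es Vs tn2 tJ2 tE2 tV2) {k : ℝ → ℝ}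
    (hk : IntervalIntegrable k volume 0 T) (hr1 : HasRate T tn1 tJ1 tE1 k)
    (hr2 : HasRate T tn2 tJ2 tE2 k)
    (hb1 : LowBound T M ns tn1 tJ1 tE1 tV1) (hb2 : LowBound T M ns tn2 tJ2 tE2 tV2) :
    AbsolutelyContinuousOnInterval
      (fun t => ∫ x in (0:ℝ)..1, energyDensity κ a tn1 tJ1 tE1 tn2 tJ2 tE2 t x) 0 T := by
  refine AbsolutelyContinuousOnInterval.of_abs_sub_le (C := (2 + κ + a) * (8 * M))
    (hk.absolutelyContinuousOnInterval_intervalIntegral left_mem_uIcc) fun s hs t ht => ?_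
  rw [uIcc_of_le hT] at hs ht
  have c1 := continuous_energyDensity (κ := κ) (a := a) h1 h2 ht
  have c2 := continuous_energyDensity (κ := κ) (a := a) h1 h2 hs
  rw [← intervalIntegral.integral_sub (c1.intervalIntegrable _ _) (c2.intervalIntegrable _ _)]
  have := intervalIntegral.norm_integral_le_of_norm_le_const (a := (0:ℝ)) (b := 1)
    (f := fun x => energyDensity κ a tn1 tJ1 tE1 tn2 tJ2 tE2 t x
      - energyDensity κ a tn1 tJ1 tE1 tn2 tJ2 tE2 s x)
    (C := (2 + κ + a) * (8 * M) * |(∫ r in (0:ℝ)..t, k r) - ∫ r in (0:ℝ)..s, k r|)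
    fun x hx => by
      rw [uIoc_of_le zero_le_one] at hx
      replace hx := Ioc_subset_Icc_self hx
      obtain ⟨d1, d2, d3, d4⟩ := abs_diff_sub_le h1 h2 hk hr1 hr2 hs ht hx
      obtain ⟨p1, p2, p3, p4⟩ := hb1.abs_diff_le hb2 ht hx
      obtain ⟨q1, q2, q3, q4⟩ := hb1.abs_diff_le hb2 hs hx
      have r1 := abs_le.1 (abs_sq_sub_sq_le p1 q1 d1)
      have r2 := abs_le.1 (abs_sq_sub_sq_le p2 q2 d2)
      have r3 := abs_le.1 (abs_sq_sub_sq_le p3 q3 d3)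
      have r4 := abs_le.1 (abs_sq_sub_sq_le p4 q4 d4)
      have m1 := mul_le_mul_of_nonneg_left r3.1 ha
      have m2 := mul_le_mul_of_nonneg_left r3.2 ha
      have m3 := mul_le_mul_of_nonneg_left r4.1 hκ
      have m4 := mul_le_mul_of_nonneg_left r4.2 hκ
      rw [Real.norm_eq_abs, abs_le]
      simp only [energyDensity]
      constructor <;> linarith [r1.1, r1.2, r2.1, r2.2]
  simpa [Real.norm_eq_abs] using this

theorem hasDerivAt_energy {κ a M t : ℝ}
    (hs : IsSteadySol ν ε τ lam μ Jb Vb ρ ns Js Es Vs)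
    (h1 : IsPerturbSol ν ε τ lam μ T ns Js Es Vs tn1 tJ1 tE1 tV1)
    (h2 : IsPerturbSol ν ε τ lam μ T ns Js Es Vs tn2 tJ2 tE2 tV2) {k : ℝ → ℝ}
    (hk : IntervalIntegrable k volume 0 T) (hr1 : HasRate T tn1 tJ1 tE1 k)
    (hr2 : HasRate T tn2 tJ2 tE2 k)
    (hb1 : LowBound T M ns tn1 tJ1 tE1 tV1) (hb2 : LowBound T M ns tn2 tJ2 tE2 tV2)
    (ht : t ∈ Ioo (0:ℝ) T) (hG : HasDerivAt (fun t => ∫ r in (0:ℝ)..t, k r) (k t) t) :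
    HasDerivAt (fun t => ∫ x in (0:ℝ)..1, energyDensity κ a tn1 tJ1 tE1 tn2 tJ2 tE2 t x)
      (2 * ∫ x in (0:ℝ)..1, energyRate κ a tn1 tJ1 tE1 tn2 tJ2 tE2 t x) t := by
  have htT := Ioo_subset_Icc_self ht
  obtain ⟨a1, a2, a3⟩ := h1.contDiffOn_tderiv hs htT
  obtain ⟨b1, b2, b3⟩ := h2.contDiffOn_tderiv hs htT
  have cpt := a1.continuousOn.sub b1.continuousOn
  have cqt := a2.continuousOn.sub b2.continuousOn
  have cet := a3.continuousOn.sub b3.continuousOn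
  have cp : ∀ s ∈ Icc (0:ℝ) T, Continuous fun x => tn1 s x - tn2 s x := fun s hs =>
    (h1.reg_n s hs).continuous.sub (h2.reg_n s hs).continuous
  have cpx : ∀ s ∈ Icc (0:ℝ) T, Continuous fun x => deriv (tn1 s) x - deriv (tn2 s) x :=
    fun s hs => ((h1.reg_n s hs).continuous_deriv (by norm_num)).sub
      ((h2.reg_n s hs).continuous_deriv (by norm_num))
  have cq : ∀ s ∈ Icc (0:ℝ) T, Continuous fun x => tJ1 s x - tJ2 s x := fun s hs =>
    (h1.reg_J s hs).continuous.sub (h2.reg_J s hs).continuous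
  have ce : ∀ s ∈ Icc (0:ℝ) T, Continuous fun x => tE1 s x - tE2 s x := fun s hs =>
    (h1.reg_E s hs).continuous.sub (h2.reg_E s hs).continuous
  have cpxx : Continuous fun x => iteratedDeriv 2 (tn1 t) x - iteratedDeriv 2 (tn2 t) x :=
    ((h1.reg_n t htT).continuous_iteratedDeriv 2 (by norm_num)).sub
      ((h2.reg_n t htT).continuous_iteratedDeriv 2 (by norm_num))
  have hdp : ∀ x ∈ Icc (0:ℝ) 1, HasDerivAt (fun s => tn1 s x - tn2 s x)
      (tderiv tn1 t x - tderiv tn2 t x) t := fun x hx =>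
    (h1.reg_t t htT x hx).1.hasDerivAt.sub (h2.reg_t t htT x hx).1.hasDerivAt
  have dp := hasDerivAt_integral_sq (w := fun s x => tn1 s x - tn2 s x)
    (fun s hs => (cp s hs).continuousOn) (fun s hs x hx => (hb1.abs_diff_le hb2 hs hx).1)
    (fun s hs x hx => (abs_diff_sub_le h1 h2 hk hr1 hr2 htT hs hx).1) ht hG hdp cpt
  have dq := hasDerivAt_integral_sq (w := fun s x => tJ1 s x - tJ2 s x)
    (fun s hs => (cq s hs).continuousOn) (fun s hs x hx => (hb1.abs_diff_le hb2 hs hx).2.1)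
    (fun s hs x hx => (abs_diff_sub_le h1 h2 hk hr1 hr2 htT hs hx).2.1) ht hG
    (fun x hx => (h1.reg_t t htT x hx).2.1.hasDerivAt.sub (h2.reg_t t htT x hx).2.1.hasDerivAt) cqt
  have de := hasDerivAt_integral_sq (w := fun s x => tE1 s x - tE2 s x)
    (fun s hs => (ce s hs).continuousOn) (fun s hs x hx => (hb1.abs_diff_le hb2 hs hx).2.2.1)
    (fun s hs x hx => (abs_diff_sub_le h1 h2 hk hr1 hr2 htT hs hx).2.2.1) ht hG
    (fun x hx => (h1.reg_t t htT x hx).2.2.1.hasDerivAt.sub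
      (h2.reg_t t htT x hx).2.2.1.hasDerivAt) cet
  have dpx := hasDerivAt_integral_sq_deriv (u := fun s x => tn1 s x - tn2 s x)
    (ux := fun s x => deriv (tn1 s) x - deriv (tn2 s) x)
    (uxx := fun x => iteratedDeriv 2 (tn1 t) x - iteratedDeriv 2 (tn2 t) x) (T := T)
    (fun s hs => by
      have z1 := h1.bc_n s hs 0 (by norm_num)
      have z2 := h2.bc_n s hs 0 (by norm_num)
      simp only [iteratedDeriv_zero] at z1 z2
      simp [z1, z2])
    (fun s hs x _ => ((h1.reg_n s hs).differentiable (by norm_num) x).hasDerivAt.sub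
      ((h2.reg_n s hs).differentiable (by norm_num) x).hasDerivAt)
    (fun s hs => (cpx s hs).continuousOn)
    (fun x _ => ((h1.reg_n t htT).hasDerivAt_deriv_two (k := 4) (by norm_num) x).sub
      ((h2.reg_n t htT).hasDerivAt_deriv_two (k := 4) (by norm_num) x))
    cpxx.continuousOn
    (fun s hs x hx => (abs_diff_sub_le h1 h2 hk hr1 hr2 htT hs hx).1)
    (fun s hs x hx => (abs_diff_sub_le h1 h2 hk hr1 hr2 htT hs hx).2.2.2) ht hG hdp cpt
  have hsum := ((dp.add (dpx.const_mul κ)).add dq).add (de.const_mul a)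
  have hI : ∀ f : ℝ → ℝ, ContinuousOn f (Icc 0 1) → IntervalIntegrable f volume 0 1 :=
    fun f hf => hf.intervalIntegrable_of_Icc zero_le_one
  have hval : 2 * ∫ x in (0:ℝ)..1, energyRate κ a tn1 tJ1 tE1 tn2 tJ2 tE2 t x
      = (∫ x in (0:ℝ)..1, 2 * ((tn1 t x - tn2 t x) * (tderiv tn1 t x - tderiv tn2 t x)))
        + κ * (-∫ x in (0:ℝ)..1, 2 * ((iteratedDeriv 2 (tn1 t) x - iteratedDeriv 2 (tn2 t) x)
          * (tderiv tn1 t x - tderiv tn2 t x)))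
        + (∫ x in (0:ℝ)..1, 2 * ((tJ1 t x - tJ2 t x) * (tderiv tJ1 t x - tderiv tJ2 t x)))
        + a * ∫ x in (0:ℝ)..1, 2 * ((tE1 t x - tE2 t x) * (tderiv tE1 t x - tderiv tE2 t x)) := by
    have i1 := hI (fun x => (tn1 t x - tn2 t x) * (tderiv tn1 t x - tderiv tn2 t x))
      ((cp t htT).continuousOn.mul cpt)
    have i2 := hI (fun x => κ * ((iteratedDeriv 2 (tn1 t) x - iteratedDeriv 2 (tn2 t) x)
      * (tderiv tn1 t x - tderiv tn2 t x))) ((cpxx.continuousOn.mul cpt).const_mul κ)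
    have i3 := hI (fun x => (tJ1 t x - tJ2 t x) * (tderiv tJ1 t x - tderiv tJ2 t x))
      ((cq t htT).continuousOn.mul cqt)
    have i4 := hI (fun x => a * ((tE1 t x - tE2 t x) * (tderiv tE1 t x - tderiv tE2 t x)))
      (((ce t htT).continuousOn.mul cet).const_mul a)
    simp only [energyRate]
    rw [intervalIntegral.integral_add ((i1.sub i2).add i3) i4,
      intervalIntegral.integral_add (i1.sub i2) i3, intervalIntegral.integral_sub i1 i2]
    simp only [intervalIntegral.integral_const_mul]
    ring
  rw [hval]
  refine hsum.congr_of_eventuallyEq ?_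
  filter_upwards [Icc_mem_nhds ht.1 ht.2] with s hs
  have i1 := hI (fun x => (tn1 s x - tn2 s x) ^ 2) ((cp s hs).pow 2).continuousOn
  have i2 := hI (fun x => κ * (deriv (tn1 s) x - deriv (tn2 s) x) ^ 2)
    (((cpx s hs).pow 2).const_mul κ).continuousOn
  have i3 := hI (fun x => (tJ1 s x - tJ2 s x) ^ 2) ((cq s hs).pow 2).continuousOn
  have i4 := hI (fun x => a * (tE1 s x - tE2 s x) ^ 2) (((ce s hs).pow 2).const_mul a).continuousOn
  simp only [energyDensity, Pi.add_apply]
  rw [intervalIntegral.integral_add ((i1.add i2).add i3) i4,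
    intervalIntegral.integral_add (i1.add i2) i3, intervalIntegral.integral_add i1 i2]
  simp only [intervalIntegral.integral_const_mul]

end energy

section energy

variable {ν ε τ lam μ T Jb Vb : ℝ} {ρ ns Js Es Vs : ℝ → ℝ}
  {tn1 tJ1 tE1 tV1 tn2 tJ2 tE2 tV2 : ℝ → ℝ → ℝ}

theorem integral_energyDensity_nonpos (hν : 0 < ν) (hε : 0 < ε) (hτ : 0 < τ) (hμ : 0 < μ)
    (hlam : 0 < lam) (hT : 0 < T)
    (hs : IsSteadySol ν ε τ lam μ Jb Vb ρ ns Js Es Vs)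
    (h1 : IsPerturbSol ν ε τ lam μ T ns Js Es Vs tn1 tJ1 tE1 tV1)
    (h2 : IsPerturbSol ν ε τ lam μ T ns Js Es Vs tn2 tJ2 tE2 tV2)
    {k : ℝ → ℝ} (hk : IntervalIntegrable k volume 0 T) (hk1 : ∀ t, 1 ≤ k t)
    (hr1 : HasRate T tn1 tJ1 tE1 k) (hr2 : HasRate T tn2 tJ2 tE2 k)
    {M a : ℝ} (hM : 1 ≤ M) (hsb : SteadyBound M ns Js Es Vs)
    (hb1 : LowBound T M ns tn1 tJ1 tE1 tV1) (hb2 : LowBound T M ns tn2 tJ2 tE2 tV2)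
    (ha : 0 < a) (ha1 : a ≤ 1)
    (hac : a * (30 * coeffBound ε τ μ M ^ 2) ^ 2 ≤ ε ^ 2 / 18 * ν ^ 2)
    (hinit : ∀ x ∈ Icc (0:ℝ) 1, tn1 0 x = tn2 0 x ∧ tJ1 0 x = tJ2 0 x ∧ tE1 0 x = tE2 0 x)
    {t : ℝ} (ht : t ∈ Icc (0:ℝ) T) :
    ∫ x in (0:ℝ)..1, energyDensity (ε ^ 2 / 18) a tn1 tJ1 tE1 tn2 tJ2 tE2 t x ≤ 0 := by
  have hκ : 0 < ε ^ 2 / 18 := by positivity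
  have hτ1 : 0 < 1 / τ := by positivity
  set A := absorbConst ν (ε ^ 2 / 18) a (30 * coeffBound ε τ μ M ^ 2) with hA
  set D := 5 * (1 + 1 / (ε ^ 2 / 18) + 1 / a + 1 / lam ^ 4) with hD
  have hA0 : 0 ≤ A := by
    rw [hA]
    unfold absorbConst
    positivity
  have hD0 : 0 ≤ D := by positivity
  refine nonpos_of_ae_hasDerivAt_le (K := fun t => 2 * (A * (2 + 2 * M ^ 2) * D) * k t)
    (F := fun t => ∫ x in (0:ℝ)..1, energyDensity (ε ^ 2 / 18) a tn1 tJ1 tE1 tn2 tJ2 tE2 t x)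
    (hk.const_mul _) (fun t _ => ?_)
    (absolutelyContinuous_energy hT.le hκ.le ha.le h1 h2 hk hr1 hr2 hb1 hb2) (le_of_eq ?_) ?_ ht
  · have := hk1 t
    positivity
  · rw [integral_congr_Ioo (g := fun _ => 0) zero_le_one, intervalIntegral.integral_zero]
    intro x hx
    obtain ⟨e1, e2, e3⟩ := hinit x (Ioo_subset_Icc_self hx)
    have e4 : deriv (tn1 0) x = deriv (tn2 0) x := by
      refine Filter.EventuallyEq.deriv_eq ?_
      filter_upwards [Icc_mem_nhds hx.1 hx.2] with y hy
      exact (hinit y hy).1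
    simp [energyDensity, e1, e2, e3, e4]
  · filter_upwards [hk.ae_hasDerivAt_integral] with t hd ht
    have htT := Ioo_subset_Icc_self ht
    have hG := hd (by rwa [uIcc_of_le hT.le]) 0 left_mem_uIcc
    refine ⟨_, hasDerivAt_energy hs h1 h2 hk hr1 hr2 hb1 hb2 ht hG, ?_⟩
    have hle := integral_energyRate_le hν hε hτ hμ hlam hs h1 h2 hM hsb hb1 hb2 ha ha1 hac htT
      (s := √(k t)) (Real.one_le_sqrt.2 (hk1 t))
      (fun x hx => Real.abs_le_sqrt (hr1.nxx t htT x hx))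
      (fun x hx => Real.abs_le_sqrt (hr2.nxx t htT x hx))
    set F := ∫ x in (0:ℝ)..1, energyDensity (ε ^ 2 / 18) a tn1 tJ1 tE1 tn2 tJ2 tE2 t x with hF
    have hF0 : 0 ≤ F := intervalIntegral.integral_nonneg zero_le_one fun x _ => by
      unfold energyDensity
      positivity
    have hsq : (√(k t) + M) ^ 2 ≤ (2 + 2 * M ^ 2) * k t := by
      have h3 := Real.sq_sqrt (zero_le_one.trans (hk1 t))
      have h4 : M ^ 2 * 1 ≤ M ^ 2 * k t := by gcongr; exact hk1 t
      linarith [sq_nonneg (√(k t) - M)]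
    have h5 := mul_le_mul_of_nonneg_right (mul_le_mul_of_nonneg_left hsq hA0)
      (mul_nonneg hD0 hF0)
    rw [← hA, ← hD] at hle
    linarith

/-- Solutions coincide where the energy of their difference vanishes. -/
theorem eq_of_integral_energyDensity_nonpos {κ a : ℝ} (hκ : 0 < κ) (ha : 0 < a) (hlam : 0 < lam)
    (h1 : IsPerturbSol ν ε τ lam μ T ns Js Es Vs tn1 tJ1 tE1 tV1)
    (h2 : IsPerturbSol ν ε τ lam μ T ns Js Es Vs tn2 tJ2 tE2 tV2) {t : ℝ}
    (ht : t ∈ Icc (0:ℝ) T)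
    (hF : ∫ x in (0:ℝ)..1, energyDensity κ a tn1 tJ1 tE1 tn2 tJ2 tE2 t x ≤ 0)
    {x : ℝ} (hx : x ∈ Icc (0:ℝ) 1) :
    tn1 t x = tn2 t x ∧ tJ1 t x = tJ2 t x ∧ tE1 t x = tE2 t x ∧ tV1 t x = tV2 t x := by
  have hc := continuous_energyDensity (κ := κ) (a := a) h1 h2 ht
  have hz : ∀ y ∈ Icc (0:ℝ) 1, energyDensity κ a tn1 tJ1 tE1 tn2 tJ2 tE2 t y = 0 := by
    by_contra! hne
    obtain ⟨y, hy, hy0⟩ := hne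
    have hnn : ∀ z, 0 ≤ energyDensity κ a tn1 tJ1 tE1 tn2 tJ2 tE2 t z := fun z => by
      unfold energyDensity
      positivity
    have := intervalIntegral.integral_pos zero_lt_one hc.continuousOn (fun z _ => hnn z)
      ⟨y, hy, lt_of_le_of_ne (hnn y) hy0.symm⟩
    linarith
  have hlow : ∀ y ∈ Icc (0:ℝ) 1,
      tn1 t y - tn2 t y = 0 ∧ tJ1 t y - tJ2 t y = 0 ∧ tE1 t y - tE2 t y = 0 := by
    intro y hy
    have h := hz y hy
    have b1 := sq_nonneg (tn1 t y - tn2 t y)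
    have b2 := mul_nonneg hκ.le (sq_nonneg (deriv (tn1 t) y - deriv (tn2 t) y))
    have b3 := sq_nonneg (tJ1 t y - tJ2 t y)
    have b4 := mul_nonneg ha.le (sq_nonneg (tE1 t y - tE2 t y))
    unfold energyDensity at h
    have c4 : a * (tE1 t y - tE2 t y) ^ 2 = 0 := by linarith
    exact ⟨pow_eq_zero_iff two_ne_zero |>.1 (by linarith),
      pow_eq_zero_iff two_ne_zero |>.1 (by linarith),
      pow_eq_zero_iff two_ne_zero |>.1 ((mul_eq_zero.1 c4).resolve_left ha.ne')⟩
  have hV : ∀ y ∈ Icc (0:ℝ) 1, deriv (tV1 t) y - deriv (tV2 t) y = 0 := by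
    intro y hy
    have h := sq_deriv_potential_sub_le hlam h1 h2 ht hy
    rw [integral_congr_Ioo (g := fun _ => 0) zero_le_one
      fun z hz => by rw [(hlow z (Ioo_subset_Icc_self hz)).1, zero_pow two_ne_zero],
      intervalIntegral.integral_zero, mul_zero] at h
    exact pow_eq_zero_iff two_ne_zero |>.1 (le_antisymm h (sq_nonneg _))
  have V1 := h1.reg_V t ht
  have V2 := h2.reg_V t ht
  have hconst := constant_of_has_deriv_right_zero (f := fun y => tV1 t y - tV2 t y) (a := 0)
    (b := 1) (V1.continuous.sub V2.continuous).continuousOn (fun y hy => by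
      have := (V1.differentiable (by norm_num) y).hasDerivAt.sub
        (V2.differentiable (by norm_num) y).hasDerivAt
      rw [hV y (Ico_subset_Icc_self hy)] at this
      exact this.hasDerivWithinAt) x hx
  simp only [(h1.bc_V t ht).1, (h2.bc_V t ht).1, sub_zero] at hconst
  obtain ⟨e1, e2, e3⟩ := hlow x hx
  exact ⟨sub_eq_zero.1 e1, sub_eq_zero.1 e2, sub_eq_zero.1 e3, sub_eq_zero.1 hconst⟩

end energy

end

/-- uniqueness of solutions of the perturbation initial-boundary value
problem with the stated regularity. -/
theorem perturbation_uniqueness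
    (ν ε τ lam μ Jb Vb T : ℝ) (hν : 0 < ν) (hε : 0 < ε) (hτ : 0 < τ)
    (hlam : 0 < lam) (hμ : 0 < μ) (hT : 0 < T)
    (ρ nstar Jstar Estar Vstar : ℝ → ℝ)
    (hsteady : IsSteadySol ν ε τ lam μ Jb Vb ρ nstar Jstar Estar Vstar)
    (tn1 tJ1 tE1 tV1 tn2 tJ2 tE2 tV2 : ℝ → ℝ → ℝ)
    (hsol1 : IsPerturbSol ν ε τ lam μ T nstar Jstar Estar Vstar tn1 tJ1 tE1 tV1)
    (hsol2 : IsPerturbSol ν ε τ lam μ T nstar Jstar Estar Vstar tn2 tJ2 tE2 tV2)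
    (hreg1 : MemH1H 2 T tn1 ∧ MemL2H 4 T tn1 ∧ MemH1H 1 T tJ1 ∧ MemL2H 3 T tJ1 ∧
      MemH1H 1 T tE1 ∧ MemL2H 3 T tE1 ∧ MemH1H 4 T tV1 ∧ MemL2H 6 T tV1)
    (hreg2 : MemH1H 2 T tn2 ∧ MemL2H 4 T tn2 ∧ MemH1H 1 T tJ2 ∧ MemL2H 3 T tJ2 ∧
      MemH1H 1 T tE2 ∧ MemL2H 3 T tE2 ∧ MemH1H 4 T tV2 ∧ MemL2H 6 T tV2)
    (hinit : ∀ x ∈ Icc (0:ℝ) 1,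
      tn1 0 x = tn2 0 x ∧ tJ1 0 x = tJ2 0 x ∧ tE1 0 x = tE2 0 x ∧ tV1 0 x = tV2 0 x) :
    ∀ t ∈ Icc (0:ℝ) T, ∀ x ∈ Icc (0:ℝ) 1,
      tn1 t x = tn2 t x ∧ tJ1 t x = tJ2 t x ∧ tE1 t x = tE2 t x ∧ tV1 t x = tV2 t x := by
  obtain ⟨hn1, hn41, hJ1, -, hE1, -⟩ := hreg1
  obtain ⟨hn2, hn42, hJ2, -, hE2, -⟩ := hreg2
  obtain ⟨k1, hk1, hk11, hr1⟩ := hsol1.exists_hasRate hsteady hn1 hn41 hJ1 hE1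
  obtain ⟨k2, hk2, hk21, hr2⟩ := hsol2.exists_hasRate hsteady hn2 hn42 hJ2 hE2
  obtain ⟨M1, hM1⟩ := hsol1.exists_lowBound hT.le hlam hsteady hk1 hr1
  obtain ⟨M2, hM2⟩ := hsol2.exists_lowBound hT.le hlam hsteady hk2 hr2
  obtain ⟨M3, hM3⟩ := hsteady.exists_steadyBound
  set M := max (max M1 M2) (max M3 1) with hM
  have hτ1 : 0 < 1 / τ := by positivity
  have hM0 : 1 ≤ M := (le_max_right _ _).trans (le_max_right _ _)
  have hc : 0 < coeffBound ε τ μ M := by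
    unfold coeffBound
    positivity
  have hκ : 0 < ε ^ 2 / 18 := by positivity
  set a := min 1 (ε ^ 2 / 18 * ν ^ 2 / (30 * coeffBound ε τ μ M ^ 2) ^ 2) with ha
  have ha0 : 0 < a := lt_min one_pos (by positivity)
  have hac : a * (30 * coeffBound ε τ μ M ^ 2) ^ 2 ≤ ε ^ 2 / 18 * ν ^ 2 :=
    (le_div_iff₀ (by positivity)).1 (min_le_right _ _)
  intro t ht x hx
  exact eq_of_integral_energyDensity_nonpos hκ ha0 hlam hsol1 hsol2 ht
    (integral_energyDensity_nonpos hν hε hτ hμ hlam hT hsteady hsol1 hsol2 (hk1.add hk2)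
      (fun t => (hk11 t).trans (le_add_of_nonneg_right (zero_le_one.trans (hk21 t))))
      (hr1.mono fun t => le_add_of_nonneg_right (zero_le_one.trans (hk21 t)))
      (hr2.mono fun t => le_add_of_nonneg_left (zero_le_one.trans (hk11 t)))
      hM0 (hM3.mono ((le_max_left _ _).trans (le_max_right _ _)))
      (hM1.mono ((le_max_left _ _).trans (le_max_left _ _)))
      (hM2.mono ((le_max_right _ _).trans (le_max_left _ _))) ha0 (min_le_left _ _) hac
      (fun x hx => ⟨(hinit x hx).1, (hinit x hx).2.1, (hinit x hx).2.2.1⟩) ht) hx
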